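/- arXiv:math/9903120 — 5 statements merged into one kernel-verified Lean document; each statement's English description precedes it below -/
import Mathlib

section
/- Let K be an algebraically closed field. Let A = A(α,β,γ) and A' = A(α',β',γ') be down-up algebras with β ≠ 0 and β' ≠ 0, and suppose they have the same type, i.e. (γ = 0 ↔ γ' = 0) and (α + β = 1 ↔ α' + β' = 1). If γ ≠ 0 and α + β = 1 (type (d)), assume moreover that char K = 0. Then A and A' are isomorphic as K-algebras if and only if (γ = 0 ↔ γ' = 0) and either (α' = α and β' = β) or (α' = −α·β^{-1} and β' = β^{-1}). -/
noncomputable section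

/-- The defining relations of the down-up algebra `A(α,β,γ)`:
generator `0` is `d`, generator `1` is `u`. -/
inductive DownUpRel (K : Type) [Field K] (α β γ : K) :
    FreeAlgebra K (Fin 2) → FreeAlgebra K (Fin 2) → Prop
  | rel1 : DownUpRel K α β γ
      (FreeAlgebra.ι K 0 * FreeAlgebra.ι K 0 * FreeAlgebra.ι K 1)
      (α • (FreeAlgebra.ι K 0 * FreeAlgebra.ι K 1 * FreeAlgebra.ι K 0) +
        β • (FreeAlgebra.ι K 1 * FreeAlgebra.ι K 0 * FreeAlgebra.ι K 0) +
        γ • FreeAlgebra.ι K 0)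
  | rel2 : DownUpRel K α β γ
      (FreeAlgebra.ι K 0 * FreeAlgebra.ι K 1 * FreeAlgebra.ι K 1)
      (α • (FreeAlgebra.ι K 1 * FreeAlgebra.ι K 0 * FreeAlgebra.ι K 1) +
        β • (FreeAlgebra.ι K 1 * FreeAlgebra.ι K 1 * FreeAlgebra.ι K 0) +
        γ • FreeAlgebra.ι K 1)

/-- The down-up algebra `A(α,β,γ)`. -/
abbrev DownUp (K : Type) [Field K] (α β γ : K) := RingQuot (DownUpRel K α β γ)

/-- The generator `d` of the down-up algebra. -/
def DownUp.d (K : Type) [Field K] (α β γ : K) : DownUp K α β γ :=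
  RingQuot.mkAlgHom K (DownUpRel K α β γ) (FreeAlgebra.ι K 0)

/-- The generator `u` of the down-up algebra. -/
def DownUp.u (K : Type) [Field K] (α β γ : K) : DownUp K α β γ :=
  RingQuot.mkAlgHom K (DownUpRel K α β γ) (FreeAlgebra.ι K 1)

namespace DownUp

section Basic

variable {K : Type} [Field K] {α β γ : K}

/-- The elements `D` and `U` of a `K`-algebra satisfy the down-up relations. -/
structure IsPair {B : Type*} [Ring B] [Algebra K B] (α β γ : K) (D U : B) : Prop where
  ddu : D * D * U = α • (D * U * D) + β • (U * D * D) + γ • D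
  duu : D * U * U = α • (U * D * U) + β • (U * U * D) + γ • U

theorem isPair_d_u : IsPair α β γ (d K α β γ) (u K α β γ) where
  ddu := by
    simpa [d, u] using RingQuot.mkAlgHom_rel K (DownUpRel.rel1 (α := α) (β := β) (γ := γ))
  duu := by
    simpa [d, u] using RingQuot.mkAlgHom_rel K (DownUpRel.rel2 (α := α) (β := β) (γ := γ))

theorem IsPair.map {B C : Type*} [Ring B] [Algebra K B] [Ring C] [Algebra K C] {D U : B}
    (h : IsPair α β γ D U) (f : B →ₐ[K] C) : IsPair α β γ (f D) (f U) where
  ddu := by simpa using congrArg f h.ddu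
  duu := by simpa using congrArg f h.duu

/-- The algebra map out of a down-up algebra given by a pair satisfying its relations. -/
def lift {B : Type*} [Ring B] [Algebra K B] {D U : B} (h : IsPair α β γ D U) :
    DownUp K α β γ →ₐ[K] B :=
  RingQuot.liftAlgHom K ⟨FreeAlgebra.lift K ![D, U], by
    intro x y hxy
    cases hxy with
    | rel1 => simpa using h.ddu
    | rel2 => simpa using h.duu⟩

@[simp]
theorem lift_d {B : Type*} [Ring B] [Algebra K B] {D U : B} (h : IsPair α β γ D U) :
    lift h (d K α β γ) = D := by
  simp [lift, d]

@[simp]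
theorem lift_u {B : Type*} [Ring B] [Algebra K B] {D U : B} (h : IsPair α β γ D U) :
    lift h (u K α β γ) = U := by
  simp [lift, u]

theorem algHom_ext {B : Type*} [Ring B] [Algebra K B] {f g : DownUp K α β γ →ₐ[K] B}
    (hd : f (d K α β γ) = g (d K α β γ)) (hu : f (u K α β γ) = g (u K α β γ)) : f = g := by
  apply RingQuot.ringQuot_ext'
  apply FreeAlgebra.hom_ext
  funext i
  fin_cases i
  · exact hd
  · exact hu

theorem adjoin_eq_top : Algebra.adjoin K {d K α β γ, u K α β γ} = ⊤ := by
  have hsurj := RingQuot.mkAlgHom_surjective K (DownUpRel K α β γ)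
  have hr : (RingQuot.mkAlgHom K (DownUpRel K α β γ)).range = ⊤ :=
    (AlgHom.range_eq_top _).2 hsurj
  rw [← hr, ← Algebra.map_top, ← FreeAlgebra.adjoin_range_ι, AlgHom.map_adjoin, ← Set.range_comp]
  congr 1
  ext x
  simp [d, u, Fin.exists_fin_two, eq_comm]

/-- Induction along a generating pair. -/
theorem induction_of_adjoin {B : Type*} [Ring B] [Algebra K B] {D U : B}
    (h : Algebra.adjoin K {D, U} = ⊤) {p : B → Prop} (hD : p D) (hU : p U)
    (hK : ∀ k : K, p (algebraMap K B k)) (hadd : ∀ x y, p x → p y → p (x + y))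
    (hmul : ∀ x y, p x → p y → p (x * y)) (x : B) : p x := by
  have hx : x ∈ Algebra.adjoin K {D, U} := h ▸ Algebra.mem_top
  induction hx using Algebra.adjoin_induction with
  | mem x hx =>
    rcases hx with rfl | rfl
    · exact hD
    · exact hU
  | algebraMap r => exact hK r
  | add x y _ _ hx hy => exact hadd x y hx hy
  | mul x y _ _ hx hy => exact hmul x y hx hy

theorem adjoin_map_eq_top {B : Type*} [Ring B] [Algebra K B] (φ : DownUp K α β γ ≃ₐ[K] B) :
    Algebra.adjoin K {φ (d K α β γ), φ (u K α β γ)} = ⊤ := by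
  have h := congrArg (Subalgebra.map (φ : DownUp K α β γ →ₐ[K] B)) (adjoin_eq_top (α := α))
  rw [AlgHom.map_adjoin, Algebra.map_top, (AlgHom.range_eq_top _).2 φ.surjective,
    Set.image_pair] at h
  exact h

/-- Rescaling the generator `d` changes `γ` by a nonzero factor. -/
theorem nonempty_algEquiv_of_zero_iff {γ' : K} (h : γ = 0 ↔ γ' = 0) :
    Nonempty (DownUp K α β γ ≃ₐ[K] DownUp K α β γ') := by
  obtain ⟨k, hk, hγ⟩ : ∃ k : K, k ≠ 0 ∧ γ = k * γ' := by
    by_cases h0 : γ' = 0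
    · exact ⟨1, one_ne_zero, by simp [h.2 h0, h0]⟩
    · exact ⟨γ / γ', div_ne_zero (mt h.1 h0) h0, by field_simp⟩
  have h1 : IsPair α β γ (k • d K α β γ') (u K α β γ') :=
    ⟨by simp only [smul_mul_assoc, mul_smul_comm, isPair_d_u.ddu, hγ]; module,
     by simp only [smul_mul_assoc, mul_smul_comm, isPair_d_u.duu, hγ]; module⟩
  have h2 : IsPair α β γ' (k⁻¹ • d K α β γ) (u K α β γ) := by
    have hγ' : γ' = k⁻¹ * γ := by rw [hγ, inv_mul_cancel_left₀ hk]
    exact ⟨by simp only [smul_mul_assoc, mul_smul_comm, isPair_d_u.ddu, hγ']; module,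
      by simp only [smul_mul_assoc, mul_smul_comm, isPair_d_u.duu, hγ']; module⟩
  exact ⟨AlgEquiv.ofAlgHom (lift h1) (lift h2)
    (algHom_ext (by simp [smul_smul, hk]) (by simp))
    (algHom_ext (by simp [smul_smul, hk]) (by simp))⟩

theorem IsPair.swap {B : Type*} [Ring B] [Algebra K B] {D U : B} (h : IsPair α β γ D U)
    (hβ : β ≠ 0) : IsPair (-α * β⁻¹) β⁻¹ (-γ * β⁻¹) U D where
  ddu := by
    have e : β • (U * U * D) = D * U * U - α • (U * D * U) - γ • U := by
      rw [h.duu]; abel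
    have e' := congrArg (fun z => β⁻¹ • z) e
    simp only [smul_smul, inv_mul_cancel₀ hβ, one_smul] at e'
    rw [e']; module
  duu := by
    have e : β • (U * D * D) = D * D * U - α • (D * U * D) - γ • D := by
      rw [h.ddu]; abel
    have e' := congrArg (fun z => β⁻¹ • z) e
    simp only [smul_smul, inv_mul_cancel₀ hβ, one_smul] at e'
    rw [e']; module

/-- Exchanging the generators `d` and `u`. -/
theorem nonempty_algEquiv_swap (hβ : β ≠ 0) :
    Nonempty (DownUp K α β γ ≃ₐ[K] DownUp K (-α * β⁻¹) β⁻¹ (-γ * β⁻¹)) := by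
  have h1 : IsPair α β γ (u K (-α * β⁻¹) β⁻¹ (-γ * β⁻¹)) (d K (-α * β⁻¹) β⁻¹ (-γ * β⁻¹)) := by
    convert (isPair_d_u (α := -α * β⁻¹) (β := β⁻¹) (γ := -γ * β⁻¹)).swap (inv_ne_zero hβ) using 1
    all_goals field_simp
  exact ⟨AlgEquiv.ofAlgHom (lift h1) (lift (isPair_d_u.swap hβ))
    (algHom_ext (by simp) (by simp)) (algHom_ext (by simp) (by simp))⟩

end Basic

section Graded

open Polynomial

variable {K : Type} [Field K]

/-- A quadratic extension of `K` generated by a root of `X ^ 2 - α X - β`. -/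
theorem exists_quadratic_algebra (α β : K) :
    ∃ (S : Type) (_ : CommRing S) (_ : Algebra K S) (t : S),
      t ^ 2 = algebraMap K S α * t + algebraMap K S β ∧
        ∀ a b : K, algebraMap K S a + algebraMap K S b * t = 0 → a = 0 ∧ b = 0 := by
  set p : K[X] := X ^ 2 - (C α * X + C β) with hp
  have hdeg : (C α * X + C β).degree < ((2 : ℕ) : WithBot ℕ) :=
    degree_linear_le.trans_lt (by norm_num)
  refine ⟨AdjoinRoot p, inferInstance, inferInstance, AdjoinRoot.root p, ?_, fun a b hab => ?_⟩
  · have h : AdjoinRoot.mk p p = 0 := AdjoinRoot.mk_self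
    rw [hp] at h
    simp only [map_sub, map_add, map_mul, map_pow, AdjoinRoot.mk_X, AdjoinRoot.mk_C] at h
    rw [AdjoinRoot.algebraMap_eq]
    linear_combination h
  · have h : AdjoinRoot.mk p (C b * X + C a) = 0 := by
      rw [AdjoinRoot.algebraMap_eq] at hab
      simp only [map_add, map_mul, AdjoinRoot.mk_X, AdjoinRoot.mk_C]
      linear_combination hab
    have hpd : p.degree = 2 := degree_sub_eq_left_of_degree_lt (by rw [degree_X_pow]; exact hdeg)
      |>.trans (degree_X_pow 2)
    have h0 : C b * X + C a = 0 := by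
      refine eq_zero_of_dvd_of_degree_lt (AdjoinRoot.mk_eq_zero.1 h) ?_
      rw [hpd]
      exact degree_linear_le.trans_lt (by norm_num)
    exact ⟨by simpa using congrArg (coeff · 0) h0, by simpa using congrArg (coeff · 1) h0⟩

theorem isUnit_root {S : Type} [CommRing S] [Algebra K S] {α β : K} {t : S} (hβ : β ≠ 0)
    (ht : t ^ 2 = algebraMap K S α * t + algebraMap K S β) : IsUnit t := by
  have hb : IsUnit (algebraMap K S β) := (IsUnit.mk0 _ hβ).map _
  refine isUnit_of_mul_isUnit_left (y := t - algebraMap K S α) ?_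
  convert hb using 1
  linear_combination ht

theorem injective_of_independent {S : Type} [CommRing S] [Algebra K S] {t : S}
    (hind : ∀ a b : K, algebraMap K S a + algebraMap K S b * t = 0 → a = 0 ∧ b = 0) :
    Function.Injective (algebraMap K S) :=
  (injective_iff_map_eq_zero _).2 fun x hx => (hind x 0 (by simp [hx])).1

theorem eq_of_root {S : Type} [CommRing S] [Algebra K S] {α β α' β' e : K} {t : S}
    (ht : t ^ 2 = algebraMap K S α' * t + algebraMap K S β')
    (hind : ∀ a b : K, algebraMap K S a + algebraMap K S b * t = 0 → a = 0 ∧ b = 0)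
    (he : algebraMap K S e * (t ^ 2 - algebraMap K S α * t - algebraMap K S β) = 0)
    (hne : e ≠ 0) : α' = α ∧ β' = β := by
  have h0 := hind (e * (β' - β)) (e * (α' - α))
    (by simp only [map_mul, map_sub]; linear_combination he - algebraMap K S e * ht)
  simp only [mul_eq_zero, hne, false_or, sub_eq_zero] at h0
  exact h0.symm

theorem eq_inv_of_root {S : Type} [CommRing S] [Algebra K S] {α β α' β' e : K} {t : S}
    (hβ : β ≠ 0) (ht : t ^ 2 = algebraMap K S α' * t + algebraMap K S β')
    (hind : ∀ a b : K, algebraMap K S a + algebraMap K S b * t = 0 → a = 0 ∧ b = 0)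
    (he : algebraMap K S e * (algebraMap K S β * t ^ 2 + algebraMap K S α * t - 1) = 0)
    (hne : e ≠ 0) : α' = -α * β⁻¹ ∧ β' = β⁻¹ := by
  have h0 := hind (e * (β * β' - 1)) (e * (β * α' + α))
    (by
      simp only [map_mul, map_sub, map_add, map_one]
      linear_combination he - algebraMap K S e * algebraMap K S β * ht)
  simp only [mul_eq_zero, hne, false_or] at h0
  obtain ⟨h1, h2⟩ := h0
  constructor
  · field_simp; linear_combination h2
  · field_simp; linear_combination h1

theorem coeff_eq_zero_of_cubic {S : Type} [CommRing S] {a b c e : S}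
    (h : C a * X ^ 3 + C b * X ^ 2 + C c * X + C e = (0 : S[X])) :
    a = 0 ∧ b = 0 ∧ c = 0 ∧ e = 0 := by
  refine ⟨?_, ?_, ?_, ?_⟩
  · simpa [coeff_X, coeff_C] using congrArg (coeff · 3) h
  · simpa [coeff_X, coeff_C] using congrArg (coeff · 2) h
  · simpa [coeff_X, coeff_C, coeff_X_pow] using congrArg (coeff · 1) h
  · simpa [coeff_X, coeff_C] using congrArg (coeff · 0) h

variable {S : Type} [CommRing S] [Algebra K S]

theorem smul_eq_C_algebraMap_mul (k : K) (q : S[X]) : k • q = C (algebraMap K S k) * q := by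
  rw [Algebra.smul_def, Polynomial.algebraMap_apply]

/-- The action of `d` on the truncated point module with parameter `X`. -/
def pointD (t : S) : Matrix (Fin 4) (Fin 4) S[X] :=
  !![0, C (t ^ 2) * X, 0, 0; 0, 0, C t * X, 0; 0, 0, 0, X; 0, 0, 0, 0]

/-- The action of `u` on the truncated point module. -/
def pointU (S : Type) [CommRing S] : Matrix (Fin 4) (Fin 4) S[X] :=
  !![0, 1, 0, 0; 0, 0, 1, 0; 0, 0, 0, 1; 0, 0, 0, 0]

theorem isPair_point {α β : K} {t : S}
    (ht : t ^ 2 = algebraMap K S α * t + algebraMap K S β) :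
    IsPair α β (0 : K) (pointD t) (pointU S) := by
  have h2 : (C t : S[X]) ^ 2 = C (algebraMap K S α) * C t + C (algebraMap K S β) := by
    rw [← C_pow, ht, C_add, C_mul]
  constructor
  · ext1 i j
    fin_cases i <;> fin_cases j <;>
      simp [pointD, pointU, Matrix.mul_apply, Fin.sum_univ_four, smul_eq_C_algebraMap_mul]
    linear_combination (C t * X ^ 2) * h2
  · ext1 i j
    fin_cases i <;> fin_cases j <;>
      simp [pointD, pointU, Matrix.mul_apply, Fin.sum_univ_four, smul_eq_C_algebraMap_mul]
    linear_combination X * h2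

/-- A matrix which to first order is the scalar `c` plus the linear form `(a, b)`, twisted by the
powers of `t`. -/
structure IsLinearForm (t : S) (c a b : K) (M : Matrix (Fin 4) (Fin 4) S[X]) : Prop where
  low : ∀ i j, j < i → M i j = 0
  diag : ∀ i, M i i = C (algebraMap K S c)
  entry01 : M 0 1 = C (algebraMap K S a * t ^ 2) * X + C (algebraMap K S b)
  entry12 : M 1 2 = C (algebraMap K S a * t) * X + C (algebraMap K S b)
  entry23 : M 2 3 = C (algebraMap K S a) * X + C (algebraMap K S b)

theorem IsLinearForm.mul {t : S} {c a b c' a' b' : K} {M N : Matrix (Fin 4) (Fin 4) S[X]}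
    (hM : IsLinearForm t c a b M) (hN : IsLinearForm t c' a' b' N) :
    IsLinearForm t (c * c') (c * a' + a * c') (c * b' + b * c') (M * N) where
  low i j hij := by
    rw [Matrix.mul_apply]
    refine Finset.sum_eq_zero fun k _ => ?_
    rcases lt_or_ge k i with h | h
    · rw [hM.low i k h, zero_mul]
    · rw [hN.low k j (hij.trans_le h), mul_zero]
  diag i := by
    rw [Matrix.mul_apply, Finset.sum_eq_single i, hM.diag, hN.diag, map_mul, C_mul]
    · intro k _ hk
      rcases lt_or_gt_of_ne hk with h | h
      · rw [hM.low i k h, zero_mul]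
      · rw [hN.low k i h, mul_zero]
    · simp
  entry01 := by
    simp [Matrix.mul_apply, Fin.sum_univ_four, hM.diag, hN.diag, hM.entry01, hN.entry01,
      hN.low 2 1 (by decide), hN.low 3 1 (by decide)]
    ring
  entry12 := by
    simp [Matrix.mul_apply, Fin.sum_univ_four, hM.diag, hN.diag, hM.entry12, hN.entry12,
      hM.low 1 0 (by decide), hN.low 3 2 (by decide)]
    ring
  entry23 := by
    simp [Matrix.mul_apply, Fin.sum_univ_four, hM.diag, hN.diag, hM.entry23, hN.entry23,
      hM.low 2 0 (by decide), hM.low 2 1 (by decide)]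
    ring

theorem IsLinearForm.add {t : S} {c a b c' a' b' : K} {M N : Matrix (Fin 4) (Fin 4) S[X]}
    (hM : IsLinearForm t c a b M) (hN : IsLinearForm t c' a' b' N) :
    IsLinearForm t (c + c') (a + a') (b + b') (M + N) where
  low i j hij := by simp [hM.low i j hij, hN.low i j hij]
  diag i := by simp [hM.diag, hN.diag]
  entry01 := by simp [hM.entry01, hN.entry01]; ring
  entry12 := by simp [hM.entry12, hN.entry12]; ring
  entry23 := by simp [hM.entry23, hN.entry23]; ring

theorem isLinearForm_algebraMap (t : S) (k : K) :
    IsLinearForm t k 0 0 (algebraMap K (Matrix (Fin 4) (Fin 4) S[X]) k) where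
  low i j hij := by simp [Matrix.algebraMap_matrix_apply, hij.ne']
  diag i := by simp [Matrix.algebraMap_matrix_apply]
  entry01 := by simp [Matrix.algebraMap_matrix_apply]
  entry12 := by simp [Matrix.algebraMap_matrix_apply]
  entry23 := by simp [Matrix.algebraMap_matrix_apply]

theorem isLinearForm_pointD (t : S) : IsLinearForm t (0 : K) 1 0 (pointD t) where
  low i j hij := by fin_cases i <;> fin_cases j <;> simp_all [pointD]
  diag i := by fin_cases i <;> simp [pointD]
  entry01 := by simp [pointD]
  entry12 := by simp [pointD]
  entry23 := by simp [pointD]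

theorem isLinearForm_pointU (t : S) : IsLinearForm t (0 : K) 0 1 (pointU S) where
  low i j hij := by fin_cases i <;> fin_cases j <;> simp_all [pointU]
  diag i := by fin_cases i <;> simp [pointU]
  entry01 := by simp [pointU]
  entry12 := by simp [pointU]
  entry23 := by simp [pointU]

theorem IsLinearForm.unique {t : S} {c a b c' a' b' : K} {M : Matrix (Fin 4) (Fin 4) S[X]}
    (hinj : Function.Injective (algebraMap K S))
    (h : IsLinearForm t c a b M) (h' : IsLinearForm t c' a' b' M) : c = c' ∧ a = a' ∧ b = b' := by
  have e := h.entry23.symm.trans h'.entry23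
  exact ⟨hinj (C_injective ((h.diag 0).symm.trans (h'.diag 0))),
    hinj (by simpa using congrArg (coeff · 1) e), hinj (by simpa using congrArg (coeff · 0) e)⟩

variable {α β : K} {t : S}

theorem exists_isLinearForm (ht : t ^ 2 = algebraMap K S α * t + algebraMap K S β)
    (x : DownUp K α β 0) :
    ∃ c a b : K, IsLinearForm t c a b (lift (isPair_point ht) x) := by
  refine induction_of_adjoin adjoin_eq_top
    (p := fun x => ∃ c a b : K, IsLinearForm t c a b (lift (isPair_point ht) x))
    ⟨0, 1, 0, by simpa using isLinearForm_pointD t⟩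
    ⟨0, 0, 1, by simpa using isLinearForm_pointU t⟩
    (fun k => ⟨k, 0, 0, by rw [AlgHom.commutes]; exact isLinearForm_algebraMap t k⟩) ?_ ?_ x
  · rintro x y ⟨c, a, b, h⟩ ⟨c', a', b', h'⟩
    exact ⟨_, _, _, by rw [map_add]; exact h.add h'⟩
  · rintro x y ⟨c, a, b, h⟩ ⟨c', a', b', h'⟩
    exact ⟨_, _, _, by rw [map_mul]; exact h.mul h'⟩

/-- The linear parts of a generating pair are linearly independent. -/
theorem det_linear_ne_zero (ht : t ^ 2 = algebraMap K S α * t + algebraMap K S β)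
    (hinj : Function.Injective (algebraMap K S))
    {D U : DownUp K α β 0} (hgen : Algebra.adjoin K {D, U} = ⊤) {c a b c' a' b' : K}
    (hD : IsLinearForm t c a b (lift (isPair_point ht) D))
    (hU : IsLinearForm t c' a' b' (lift (isPair_point ht) U)) : a * b' - b * a' ≠ 0 := by
  intro hdet
  obtain ⟨f, g, hfg, h1, h2⟩ : ∃ f g : K, ¬ (f = 0 ∧ g = 0) ∧ f * a + g * b = 0 ∧
      f * a' + g * b' = 0 := by
    by_cases h : a = 0 ∧ b = 0
    · obtain ⟨rfl, rfl⟩ := h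
      by_cases h' : a' = 0 ∧ b' = 0
      · obtain ⟨rfl, rfl⟩ := h'
        exact ⟨1, 0, by simp, by simp, by simp⟩
      · exact ⟨b', -a', by simpa [and_comm] using h', by simp, by ring⟩
    · exact ⟨b, -a, by simpa [and_comm] using h, by ring, by linear_combination -hdet⟩
  have key : ∀ x : DownUp K α β 0, ∃ c a b : K,
      IsLinearForm t c a b (lift (isPair_point ht) x) ∧ f * a + g * b = 0 := by
    intro x
    refine induction_of_adjoin hgen (p := fun x => ∃ c a b : K,
      IsLinearForm t c a b (lift (isPair_point ht) x) ∧ f * a + g * b = 0)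
      ⟨c, a, b, hD, h1⟩ ⟨c', a', b', hU, h2⟩
      (fun k => ⟨k, 0, 0, by rw [AlgHom.commutes]; exact isLinearForm_algebraMap t k,
        by simp⟩) ?_ ?_ x
    · rintro x y ⟨c, a, b, h, e⟩ ⟨c', a', b', h', e'⟩
      exact ⟨_, _, _, by rw [map_add]; exact h.add h', by linear_combination e + e'⟩
    · rintro x y ⟨c, a, b, h, e⟩ ⟨c', a', b', h', e'⟩
      exact ⟨_, _, _, by rw [map_mul]; exact h.mul h', by linear_combination c' * e + c * e'⟩
  apply hfg
  constructor
  · obtain ⟨c, a, b, h, e⟩ := key (d K α β 0)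
    rw [lift_d] at h
    obtain ⟨-, rfl, rfl⟩ := h.unique hinj (isLinearForm_pointD t)
    simpa using e
  · obtain ⟨c, a, b, h, e⟩ := key (u K α β 0)
    rw [lift_u] at h
    obtain ⟨-, rfl, rfl⟩ := h.unique hinj (isLinearForm_pointU t)
    simpa using e

/-- A shifted pair of linear forms satisfying the relations is again a pair, after moving the
constant terms to zero. -/
theorem exists_centered_pair {α' β' : K} (ht : t ^ 2 = algebraMap K S α' * t + algebraMap K S β')
    (hind : ∀ a b : K, algebraMap K S a + algebraMap K S b * t = 0 → a = 0 ∧ b = 0)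
    (hβ' : β' ≠ 0) {M N : Matrix (Fin 4) (Fin 4) S[X]} {c a b c' a' b' : K}
    (hM : IsLinearForm t c a b M) (hN : IsLinearForm t c' a' b' N)
    (hdet : a * b' - b * a' ≠ 0) (hP : IsPair α β (0 : K) M N) :
    ∃ M N : Matrix (Fin 4) (Fin 4) S[X], IsLinearForm t 0 a b M ∧ IsLinearForm t 0 a' b' N ∧
      IsPair α β (0 : K) M N := by
  have hinj := injective_of_independent hind
  by_cases hαβ : α + β = 1
  · by_cases hβ : β = -1
    · have hα : α = 2 := by linear_combination hαβ - hβ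
      subst hβ hα
      refine ⟨M + algebraMap K _ (-c), N + algebraMap K _ (-c'), ?_, ?_, ?_, ?_⟩
      · simpa using hM.add (isLinearForm_algebraMap t (-c))
      · simpa using hN.add (isLinearForm_algebraMap t (-c'))
      · have h := hP.ddu
        simp only [Algebra.algebraMap_eq_smul_one, mul_add, add_mul, smul_mul_assoc,
          mul_smul_comm, one_mul, mul_one, smul_add] at h ⊢
        rw [h]
        module
      · have h := hP.duu
        simp only [Algebra.algebraMap_eq_smul_one, mul_add, add_mul, smul_mul_assoc,
          mul_smul_comm, one_mul, mul_one, smul_add] at h ⊢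
        rw [h]
        module
    · have htunit := isUnit_root hβ' ht
      have hα : α = 1 - β := by linear_combination hαβ
      subst hα
      have hvanish : ∀ k : K,
          C (algebraMap K S k) * (M 0 1 * N 1 2 - N 0 1 * M 1 2) = 0 → k = 0 := by
        intro k hk
        rw [hM.entry01, hN.entry01, hM.entry12, hN.entry12] at hk
        have e : C (algebraMap K S (k * (a * b' - b * a')) * (t * (t - 1))) * X = (0 : S[X]) := by
          rw [← hk]
          simp only [map_mul, map_sub, map_one, map_pow]
          ring
        have e1 : algebraMap K S (k * (a * b' - b * a')) * (t * (t - 1)) = 0 := by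
          simpa using congrArg (coeff · 1) e
        have e2 : t * (algebraMap K S (-(k * (a * b' - b * a')))
            + algebraMap K S (k * (a * b' - b * a')) * t) = 0 := by
          rw [map_neg]
          linear_combination e1
        exact (mul_eq_zero.1 (hind _ _ ((htunit.mul_right_eq_zero).1 e2)).2).resolve_right hdet
      have hβ1 : 1 + β ≠ 0 := fun h => hβ (by linear_combination h)
      have hc : c = 0 := by
        refine (mul_eq_zero.1 (hvanish (c * (1 + β)) ?_)).resolve_right hβ1
        have h := congrFun (congrFun hP.ddu 0) 2
        simp only [Matrix.mul_apply, Fin.sum_univ_four, Matrix.add_apply, Matrix.smul_apply,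
          smul_eq_C_algebraMap_mul, hM.diag, hN.diag, hM.low 1 0 (by decide),
          hM.low 2 0 (by decide), hM.low 2 1 (by decide), hM.low 3 0 (by decide),
          hM.low 3 1 (by decide), hM.low 3 2 (by decide), hN.low 1 0 (by decide),
          hN.low 2 0 (by decide), hN.low 2 1 (by decide), hN.low 3 0 (by decide),
          hN.low 3 1 (by decide), hN.low 3 2 (by decide), map_zero, map_sub, map_one] at h
        simp only [map_mul, map_add, map_one]
        linear_combination h
      have hc' : c' = 0 := by
        refine (mul_eq_zero.1 (hvanish (c' * (1 + β)) ?_)).resolve_right hβ1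
        have h := congrFun (congrFun hP.duu 0) 2
        simp only [Matrix.mul_apply, Fin.sum_univ_four, Matrix.add_apply, Matrix.smul_apply,
          smul_eq_C_algebraMap_mul, hM.diag, hN.diag, hM.low 1 0 (by decide),
          hM.low 2 0 (by decide), hM.low 2 1 (by decide), hM.low 3 0 (by decide),
          hM.low 3 1 (by decide), hM.low 3 2 (by decide), hN.low 1 0 (by decide),
          hN.low 2 0 (by decide), hN.low 2 1 (by decide), hN.low 3 0 (by decide),
          hN.low 3 1 (by decide), hN.low 3 2 (by decide), map_zero, map_sub, map_one] at h
        simp only [map_mul, map_add, map_one]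
        linear_combination h
      subst hc hc'
      exact ⟨M, N, hM, hN, hP⟩
  · have h1 := hP.ddu
    have h2 := hP.duu
    simp only [Algebra.smul_def, map_zero, zero_mul, add_zero] at h1 h2
    have f1 := ((isLinearForm_algebraMap t α).mul ((hM.mul hN).mul hM)).add
      ((isLinearForm_algebraMap t β).mul ((hN.mul hM).mul hM))
    have f2 := ((isLinearForm_algebraMap t α).mul ((hN.mul hM).mul hN)).add
      ((isLinearForm_algebraMap t β).mul ((hN.mul hN).mul hM))
    rw [← h1] at f1
    rw [← h2] at f2
    have e1 := ((hM.mul hM).mul hN).unique hinj f1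
    have e2 := ((hM.mul hN).mul hN).unique hinj f2
    obtain ⟨p1, p2, p3⟩ := e1
    obtain ⟨q1, q2, q3⟩ := e2
    have hne : 1 - α - β ≠ 0 := fun h => hαβ (by linear_combination -h)
    have hcc : c * c' = 0 := by
      have h : (1 - α - β) * (c * c') * (c * c') = 0 := by linear_combination c' * p1
      simpa [hne] using h
    have hc : c = 0 := by
      have e1 : (1 - α - β) * (c ^ 2 * (a * b' - b * a')) = 0 := by
        linear_combination a * p3 - b * p2
      simpa [hne, hdet] using e1
    have hc' : c' = 0 := by
      have e1 : (1 - α - β) * (c' ^ 2 * (a * b' - b * a')) = 0 := by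
        linear_combination b' * q2 - a' * q3
      simpa [hne, hdet] using e1
    subst hc hc'
    exact ⟨M, N, hM, hN, hP⟩

/-- Isomorphic down-up algebras with `γ = 0` have equal or inverse parameters. -/
theorem parameters_of_graded {α' β' : K} (hβ : β ≠ 0) (hβ' : β' ≠ 0)
    (φ : DownUp K α β 0 ≃ₐ[K] DownUp K α' β' 0) :
    (α' = α ∧ β' = β) ∨ (α' = -α * β⁻¹ ∧ β' = β⁻¹) := by
  obtain ⟨S, _, _, t, ht, hind⟩ := exists_quadratic_algebra α' β'
  have hinj := injective_of_independent hind
  have htunit := isUnit_root hβ' ht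
  obtain ⟨c, a, b, hD⟩ := exists_isLinearForm ht (φ (d K α β 0))
  obtain ⟨c', a', b', hU⟩ := exists_isLinearForm ht (φ (u K α β 0))
  have hdet := det_linear_ne_zero ht hinj (adjoin_map_eq_top φ) hD hU
  obtain ⟨M, N, hM, hN, hP⟩ := exists_centered_pair ht hind hβ' hD hU hdet
    ((isPair_d_u.map φ.toAlgHom).map (lift (isPair_point ht)))
  have h := congrFun (congrFun hP.ddu 0) 3
  simp only [Matrix.mul_apply, Fin.sum_univ_four, Matrix.add_apply, Matrix.smul_apply,
    smul_eq_C_algebraMap_mul, hM.diag, hN.diag, hM.low 1 0 (by decide),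
    hM.low 2 0 (by decide), hM.low 2 1 (by decide), hM.low 3 0 (by decide),
    hM.low 3 1 (by decide), hM.low 3 2 (by decide), hN.low 1 0 (by decide),
    hN.low 2 0 (by decide), hN.low 2 1 (by decide), hN.low 3 0 (by decide),
    hN.low 3 1 (by decide), hN.low 3 2 (by decide), map_zero, hM.entry01, hM.entry12,
    hM.entry23, hN.entry01, hN.entry12, hN.entry23] at h
  set A := algebraMap K S with hA
  obtain ⟨k3, k2, k1, k0⟩ := coeff_eq_zero_of_cubic (S := S)
    (a := A (a ^ 2 * a' * (1 - α - β)) * t ^ 3)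
    (b := A a ^ 2 * A b' * (t ^ 3 - A α * t ^ 2 - A β * t) + A a * A a' * A b *
      (t ^ 2 + t - A α * (t ^ 3 + t) - A β * (t ^ 3 + t ^ 2)))
    (c := A a * A b * A b' * (t ^ 2 + t - A α * (t ^ 2 + 1) - A β * (t + 1)) + A b ^ 2 * A a' *
      (1 - A α * t - A β * t ^ 2))
    (e := A (b ^ 2 * b' * (1 - α - β)))
    (by
      simp only [map_mul, map_sub, map_one, map_pow, map_add] at h ⊢
      linear_combination h)
  by_cases hαβ : α + β = 1
  · have hα : α = 1 - β := by linear_combination hαβ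
    have hAα : A α = 1 - A β := by rw [hα, map_sub, map_one]
    by_cases ha : a = 0
    · right
      have hb : b ≠ 0 := by rintro rfl; simp [ha] at hdet
      refine eq_inv_of_root (e := b * (a * b' - b * a')) hβ ht hind ?_ (mul_ne_zero hb hdet)
      simp only [map_mul, map_sub]
      rw [hAα] at k1 ⊢
      linear_combination k1
    · left
      refine eq_of_root (e := a * (a * b' - b * a')) ht hind
        (htunit.mul_right_eq_zero.1 ?_) (mul_ne_zero ha hdet)
      simp only [map_mul, map_sub]
      rw [hAα] at k2 ⊢
      linear_combination k2
  · have hne : 1 - α - β ≠ 0 := fun h => hαβ (by linear_combination -h)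
    have k3' : a = 0 ∨ a' = 0 := by
      have e := (map_eq_zero_iff A hinj).1 (((htunit.pow 3).mul_left_eq_zero).1 k3)
      simpa [hne] using e
    have k0' : b = 0 ∨ b' = 0 := by
      have e := (map_eq_zero_iff A hinj).1 k0
      simpa [hne] using e
    by_cases ha : a = 0
    · right
      subst ha
      have hb : b ≠ 0 := by rintro rfl; simp at hdet
      have ha' : a' ≠ 0 := by rintro rfl; simp at hdet
      refine eq_inv_of_root (e := b ^ 2 * a') hβ ht hind ?_ (mul_ne_zero (pow_ne_zero 2 hb) ha')
      simp only [map_mul, map_pow, map_zero] at k1 ⊢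
      linear_combination -k1
    · left
      have ha' := k3'.resolve_left ha
      subst ha'
      have hb' : b' ≠ 0 := by rintro rfl; simp at hdet
      refine eq_of_root (e := a ^ 2 * b') ht hind (htunit.mul_right_eq_zero.1 ?_)
        (mul_ne_zero (pow_ne_zero 2 ha) hb')
      simp only [map_mul, map_pow, map_zero] at k2 ⊢
      linear_combination k2

end Graded

section Hyperbola

open LaurentPolynomial

variable {K : Type} [Field K] {α β γ : K}

theorem exists_eq_C_mul_T_of_isUnit {P : K[T;T⁻¹]} (hP : IsUnit P) :
    ∃ (κ : K) (n : ℤ), κ ≠ 0 ∧ P = C κ * T n := by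
  obtain ⟨Q, hPQ⟩ := hP.exists_right_inv
  obtain ⟨m, p, hp⟩ := exists_T_pow P
  obtain ⟨m', q, hq⟩ := exists_T_pow Q
  have h : Polynomial.toLaurent (p * q) =
      Polynomial.toLaurent (Polynomial.X ^ (m + m') : Polynomial K) := by
    rw [map_mul, hp, hq, Polynomial.toLaurent_X_pow]
    calc P * T m * (Q * T m') = P * Q * (T m * T m') := by ring
      _ = _ := by rw [hPQ, one_mul, ← T_add]; push_cast; rfl
  have h2 := Polynomial.toLaurent_injective h
  obtain ⟨i, -, hi⟩ := (dvd_prime_pow Polynomial.prime_X _).1 (Dvd.intro q h2)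
  obtain ⟨v, hv⟩ := hi.symm
  obtain ⟨κ, hκ, hκv⟩ := Polynomial.isUnit_iff.1 v.isUnit
  refine ⟨κ, i - m, hκ.ne_zero, ?_⟩
  have h3 : P = Polynomial.toLaurent p * T (-m) := by
    rw [hp, mul_assoc, ← T_add, add_neg_cancel, T_zero, mul_one]
  rw [h3, ← hv, ← hκv, map_mul, Polynomial.toLaurent_X_pow, Polynomial.toLaurent_C, mul_comm (T _),
    mul_assoc, ← T_add, sub_eq_add_neg]

theorem isPair_of_mul_eq {B : Type*} [CommRing B] [Algebra K B] {D U : B} {c : K}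
    (hc : α * c + β * c + γ = c) (h : D * U = algebraMap K B c) : IsPair α β γ D U := by
  have hc' := congrArg (algebraMap K B) hc
  simp only [map_add, map_mul] at hc'
  constructor <;> simp only [Algebra.smul_def]
  · linear_combination (D * (1 - algebraMap K B α - algebraMap K B β)) * h - D * hc'
  · linear_combination (U * (1 - algebraMap K B α - algebraMap K B β)) * h - U * hc'

theorem isPair_laurent {c : K} (hc : α * c + β * c + γ = c) :
    IsPair α β γ (T 1 : K[T;T⁻¹]) (C c * T (-1)) :=
  isPair_of_mul_eq hc <| by
    rw [mul_left_comm, ← T_add, add_neg_cancel, T_zero, mul_one]; rfl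

theorem eq_of_C_mul_T_eq {a b : K} {m n : ℤ} (ha : a ≠ 0)
    (h : (C a * T m : K[T;T⁻¹]) = C b * T n) : m = n := by
  rw [← single_eq_C_mul_T, ← single_eq_C_mul_T] at h
  rcases AddMonoidAlgebra.single_inj.1 h with h | h
  · exact h.1
  · exact absurd h.1 ha

theorem exists_zpow_eq {κ : K} {n : ℤ} {P : K[T;T⁻¹]ˣ} (hκ : κ ≠ 0) (hP : (P : K[T;T⁻¹]) = C κ * T n)
    (m : ℤ) : ∃ κ' : K, κ' ≠ 0 ∧ ((P ^ m : K[T;T⁻¹]ˣ) : K[T;T⁻¹]) = C κ' * T (n * m) := by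
  have hinv : ((P⁻¹ : K[T;T⁻¹]ˣ) : K[T;T⁻¹]) = C κ⁻¹ * T (-n) := by
    refine Units.inv_eq_of_mul_eq_one_right ?_
    rw [hP, mul_mul_mul_comm, ← map_mul, ← T_add, mul_inv_cancel₀ hκ, add_neg_cancel, T_zero,
      map_one, mul_one]
  induction m using Int.induction_on with
  | zero => exact ⟨1, one_ne_zero, by simp⟩
  | succ m ih =>
    obtain ⟨k, hk, e⟩ := ih
    refine ⟨k * κ, mul_ne_zero hk hκ, ?_⟩
    rw [zpow_add_one, Units.val_mul, e, hP, mul_add, mul_one, T_add, map_mul]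
    ring
  | pred m ih =>
    obtain ⟨k, hk, e⟩ := ih
    refine ⟨k * κ⁻¹, mul_ne_zero hk (inv_ne_zero hκ), ?_⟩
    rw [zpow_sub_one, Units.val_mul, e, hinv, mul_sub, mul_one, sub_eq_add_neg, T_add, map_mul]
    ring

/-- A nonscalar algebra map from a down-up algebra to Laurent polynomials is monomial. -/
theorem exists_monomial {c : K} (hγ : γ ≠ 0) (hc : α * c + β * c + γ = c)
    (f : DownUp K α β γ →ₐ[K] K[T;T⁻¹]) (hf : ∃ x, ∀ k, f x ≠ algebraMap K _ k) :
    ∃ (κ : K) (n : ℤ), κ ≠ 0 ∧ f (d K α β γ) = C κ * T n ∧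
      f (d K α β γ) * f (u K α β γ) = algebraMap K _ c := by
  have hcne : c ≠ 0 := by rintro rfl; simp at hc; exact hγ hc
  have hαβ : 1 - α - β ≠ 0 := by
    intro h; exact hγ (by linear_combination hc + c * h)
  have hpair := isPair_d_u.map f
  set P := f (d K α β γ)
  set Q := f (u K α β γ)
  have hPQ : P * Q = algebraMap K _ c := by
    have hγ' : γ = (1 - α - β) * c := by linear_combination hc
    have e1 : algebraMap K K[T;T⁻¹] (1 - α - β) * (P * (P * Q - algebraMap K _ c)) = 0 := by
      have h := hpair.ddu
      simp only [Algebra.smul_def, hγ', map_mul, map_sub, map_one] at h ⊢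
      linear_combination h
    have e2 : algebraMap K K[T;T⁻¹] (1 - α - β) * (Q * (P * Q - algebraMap K _ c)) = 0 := by
      have h := hpair.duu
      simp only [Algebra.smul_def, hγ', map_mul, map_sub, map_one] at h ⊢
      linear_combination h
    have hu : IsUnit (algebraMap K K[T;T⁻¹] (1 - α - β)) := (IsUnit.mk0 _ hαβ).map _
    rcases mul_eq_zero.1 (hu.mul_right_eq_zero.1 e1) with h | h
    · rcases mul_eq_zero.1 (hu.mul_right_eq_zero.1 e2) with h' | h'
      · exfalso
        obtain ⟨x, hx⟩ := hf
        obtain ⟨k, hk⟩ := induction_of_adjoin adjoin_eq_top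
          (p := fun x => ∃ k, f x = algebraMap K _ k)
          ⟨0, by rw [map_zero]; exact h⟩ ⟨0, by rw [map_zero]; exact h'⟩
          (fun k => ⟨k, f.commutes k⟩)
          (fun x y ⟨k, hk⟩ ⟨l, hl⟩ => ⟨k + l, by simp [hk, hl]⟩)
          (fun x y ⟨k, hk⟩ ⟨l, hl⟩ => ⟨k * l, by simp [hk, hl]⟩) x
        exact hx k hk
      · exact sub_eq_zero.1 h'
    · exact sub_eq_zero.1 h
  have hunit : IsUnit P := isUnit_of_mul_isUnit_left (y := Q) (hPQ ▸ (IsUnit.mk0 _ hcne).map _)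
  obtain ⟨κ, n, hκ, h⟩ := exists_eq_C_mul_T_of_isUnit hunit
  exact ⟨κ, n, hκ, h, hPQ⟩

theorem eval₂_lift_laurent {B : Type} [CommRing B] [Algebra K B] {c : K}
    (hc : α * c + β * c + γ = c) (f : DownUp K α β γ →ₐ[K] B) (P : Bˣ)
    (hP : f (d K α β γ) = P) (hPU : f (d K α β γ) * f (u K α β γ) = algebraMap K B c)
    (x : DownUp K α β γ) :
    eval₂ (algebraMap K B) P (lift (isPair_laurent hc) x) = f x := by
  refine induction_of_adjoin adjoin_eq_top
    (p := fun x => eval₂ (algebraMap K B) P (lift (isPair_laurent hc) x) = f x) ?_ ?_ ?_ ?_ ?_ x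
  · rw [lift_d, eval₂_T, zpow_one, hP]
  · rw [lift_u, eval₂_C_mul_T, zpow_neg, zpow_one, ← hPU, hP, mul_comm, Units.inv_mul_cancel_left]
  · intro k
    rw [AlgHom.commutes, AlgHom.commutes]
    exact eval₂_C _ _ _
  · intro x y hx hy
    rw [map_add, map_add, map_add, hx, hy]
  · intro x y hx hy
    rw [map_mul, map_mul, map_mul, hx, hy]

variable {α' β' γ' : K}

/-- An isomorphism acts on the hyperbola of one-dimensional representations by
`T ↦ κ T` or `T ↦ κ T⁻¹`. -/
theorem exists_monomial_of_algEquiv {c c' : K} (hγ : γ ≠ 0) (hc : α * c + β * c + γ = c)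
    (hγ' : γ' ≠ 0) (hc' : α' * c' + β' * c' + γ' = c')
    (φ : DownUp K α β γ ≃ₐ[K] DownUp K α' β' γ') :
    ∃ (κ : K) (n : ℤ), κ ≠ 0 ∧ (n = 1 ∨ n = -1) ∧
      lift (isPair_laurent hc') (φ (d K α β γ)) = C κ * T n ∧
      lift (isPair_laurent hc') (φ (d K α β γ)) * lift (isPair_laurent hc') (φ (u K α β γ)) =
        algebraMap K _ c := by
  have hT : ∀ k : K, (T 1 : K[T;T⁻¹]) ≠ algebraMap K _ k := by
    intro k hk
    have h : (C 1 * T 1 : K[T;T⁻¹]) = C k * T 0 := by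
      rw [map_one, one_mul, hk, T_zero, mul_one]; rfl
    exact absurd (eq_of_C_mul_T_eq one_ne_zero h) one_ne_zero
  obtain ⟨κ, n, hκ, hd, hdu⟩ := exists_monomial hγ hc
    ((lift (isPair_laurent hc')).comp (φ : DownUp K α β γ →ₐ[K] DownUp K α' β' γ'))
    ⟨φ.symm (d K α' β' γ'), by simpa using hT⟩
  obtain ⟨κ', m, hκ', hd', hdu'⟩ := exists_monomial hγ' hc'
    ((lift (isPair_laurent hc)).comp (φ.symm : DownUp K α' β' γ' →ₐ[K] DownUp K α β γ))
    ⟨φ (d K α β γ), by simpa using hT⟩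
  refine ⟨κ, n, hκ, ?_, hd, hdu⟩
  have hunit : IsUnit (C κ * T n : K[T;T⁻¹]) := ((IsUnit.mk0 _ hκ).map _).mul (isUnit_T n)
  obtain ⟨P, hP⟩ := hunit
  have h : eval₂ (algebraMap K K[T;T⁻¹]) P
      (lift (isPair_laurent hc) (φ.symm (d K α' β' γ'))) =
      lift (isPair_laurent hc') (φ (φ.symm (d K α' β' γ'))) :=
    eval₂_lift_laurent hc ((lift (isPair_laurent hc')).comp
      (φ : DownUp K α β γ →ₐ[K] DownUp K α' β' γ')) P (hd.trans hP.symm) hdu _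
  replace hd' : lift (isPair_laurent hc) (φ.symm (d K α' β' γ')) = C κ' * T m := hd'
  rw [φ.apply_symm_apply, lift_d] at h
  obtain ⟨k, hk, e⟩ := exists_zpow_eq hκ hP m
  rw [hd', eval₂_C_mul_T, e] at h
  have h' : (C (κ' * k) * T (n * m) : K[T;T⁻¹]) = C 1 * T 1 := by
    rw [map_one, one_mul, ← h, map_mul, mul_assoc]; rfl
  exact Int.eq_one_or_neg_one_of_mul_eq_one (eq_of_C_mul_T_eq (mul_ne_zero hκ' hk) h')

/-- If a scalar kills the commutator of two generators, it kills all commutators. -/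
theorem smul_commutator_eq {B S : Type} [Ring B] [Algebra K B] [CommRing S] [Algebra K S]
    {D U : B} (hgen : Algebra.adjoin K {D, U} = ⊤) (f : B →ₐ[K] Matrix (Fin 2) (Fin 2) S) (s : S)
    (h : s • (f D * f U) = s • (f U * f D)) (x y : B) : s • (f x * f y) = s • (f y * f x) := by
  have step : ∀ w, s • (f w * f D) = s • (f D * f w) → s • (f w * f U) = s • (f U * f w) →
      ∀ x, s • (f w * f x) = s • (f x * f w) := by
    intro w h1 h2 x
    refine induction_of_adjoin hgen (p := fun x => s • (f w * f x) = s • (f x * f w)) h1 h2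
      (fun k => by rw [AlgHom.commutes, Algebra.commutes]) (fun x y hx hy => ?_)
      (fun x y hx hy => ?_) x
    · rw [map_add, mul_add, add_mul, smul_add, smul_add, hx, hy]
    · rw [map_mul, ← mul_assoc, ← smul_mul_assoc, hx, smul_mul_assoc, mul_assoc,
        ← mul_smul_comm, hy, mul_smul_comm, mul_assoc]
  exact step x (step D rfl h x).symm (step U h.symm rfl x).symm y

/-- A two-dimensional representation glueing two points of the hyperbola. -/
theorem isPair_glue {S : Type} [CommRing S] [Algebra K S] {c : K} (hc : α * c + β * c + γ = c)
    (t : Sˣ) (ht : (t : S) ^ 2 = algebraMap K S α * t + algebraMap K S β) :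
    IsPair α β γ !![(t : S), 0; 0, 1]
      !![algebraMap K S c * (t⁻¹ : Sˣ), 1; 0, algebraMap K S c] := by
  have hc' := congrArg (algebraMap K S) hc
  have hi : (t : S) * (t⁻¹ : Sˣ) = 1 := t.mul_inv
  simp only [map_add, map_mul] at hc'
  set v : S := ((t⁻¹ : Sˣ) : S)
  constructor
  · ext1 i j
    fin_cases i <;> fin_cases j <;>
      simp [Matrix.mul_apply] <;> simp only [Algebra.smul_def]
    · linear_combination (algebraMap K S c * t) * (1 - algebraMap K S α - algebraMap K S β) * hi
        - t * hc'
    · linear_combination ht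
    · linear_combination - hc'
  · ext1 i j
    fin_cases i <;> fin_cases j <;>
      simp [Matrix.mul_apply] <;> simp only [Algebra.smul_def]
    · linear_combination (algebraMap K S c ^ 2 * v) * (1 - algebraMap K S α - algebraMap K S β) * hi
        - algebraMap K S c * v * hc'
    · linear_combination -hc' + v * algebraMap K S c * ht + algebraMap K S c * (1 - t) * hi
    · linear_combination -algebraMap K S c * hc'

theorem lift_glue_entries {S : Type} [CommRing S] [Algebra K S] {c : K}
    (hc : α * c + β * c + γ = c) (t : Sˣ) (ht : (t : S) ^ 2 = algebraMap K S α * t + algebraMap K S β)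
    (x : DownUp K α β γ) :
    lift (isPair_glue hc t ht) x 1 0 = 0 ∧
      lift (isPair_glue hc t ht) x 0 0 = eval₂ (algebraMap K S) t (lift (isPair_laurent hc) x) ∧
      lift (isPair_glue hc t ht) x 1 1 = eval₂ (algebraMap K S) 1 (lift (isPair_laurent hc) x) := by
  refine induction_of_adjoin adjoin_eq_top (p := fun x => lift (isPair_glue hc t ht) x 1 0 = 0 ∧
      lift (isPair_glue hc t ht) x 0 0 = eval₂ (algebraMap K S) t (lift (isPair_laurent hc) x) ∧
      lift (isPair_glue hc t ht) x 1 1 = eval₂ (algebraMap K S) 1 (lift (isPair_laurent hc) x))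
    ?_ ?_ ?_ ?_ ?_ x
  · simp only [lift_d, eval₂_T]
    simp
  · simp only [lift_u, eval₂_C_mul_T]
    simp
  · intro k
    have hk : ∀ s : Sˣ, eval₂ (algebraMap K S) s (algebraMap K K[T;T⁻¹] k) = algebraMap K S k :=
      fun s => eval₂_C _ _ _
    simp only [AlgHom.commutes, hk, Matrix.algebraMap_matrix_apply]
    simp
  · rintro x y ⟨h1, h2, h3⟩ ⟨h1', h2', h3'⟩
    simp only [map_add, Matrix.add_apply, h1, h2, h3, h1', h2', h3']
    simp
  · rintro x y ⟨h1, h2, h3⟩ ⟨h1', h2', h3'⟩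
    simp only [map_mul, Matrix.mul_apply, Fin.sum_univ_two, h1, h2, h3, h1', h2', h3']
    simp

/-- Isomorphic down-up algebras with `γ ≠ 0` and `α + β ≠ 1` have equal or inverse parameters. -/
theorem parameters_of_hyperbolic (hβ : β ≠ 0) (hβ' : β' ≠ 0) (hγ : γ ≠ 0) (hγ' : γ' ≠ 0)
    (hαβ : α + β ≠ 1) (hαβ' : α' + β' ≠ 1) (φ : DownUp K α β γ ≃ₐ[K] DownUp K α' β' γ') :
    (α' = α ∧ β' = β) ∨ (α' = -α * β⁻¹ ∧ β' = β⁻¹) := by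
  have hne : 1 - α - β ≠ 0 := fun h => hαβ (by linear_combination -h)
  have hne' : 1 - α' - β' ≠ 0 := fun h => hαβ' (by linear_combination -h)
  obtain ⟨c, hc⟩ : ∃ c : K, α * c + β * c + γ = c :=
    ⟨γ / (1 - α - β), by field_simp; ring⟩
  obtain ⟨c', hc'⟩ : ∃ c : K, α' * c + β' * c + γ' = c :=
    ⟨γ' / (1 - α' - β'), by field_simp; ring⟩
  obtain ⟨κ, n, hκ, hn, hd, hdu⟩ := exists_monomial_of_algEquiv hγ hc hγ' hc' φ
  obtain ⟨S, _, _, t, ht, hind⟩ := exists_quadratic_algebra α' β'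
  obtain ⟨t, rfl⟩ := isUnit_root hβ' ht
  obtain ⟨-, m0, m1⟩ := lift_glue_entries hc' t ht (φ (d K α β γ))
  obtain ⟨-, n0, n1⟩ := lift_glue_entries hc' t ht (φ (u K α β γ))
  have mn : ∀ s : Sˣ, eval₂ (algebraMap K S) s (lift (isPair_laurent hc') (φ (d K α β γ))) *
      eval₂ (algebraMap K S) s (lift (isPair_laurent hc') (φ (u K α β γ))) = algebraMap K S c := by
    intro s
    rw [← map_mul, hdu]
    exact eval₂_C _ _ _
  have mn0 := mn t
  have mn1 := mn 1
  rw [← m0, ← n0] at mn0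
  rw [← m1, ← n1] at mn1
  rw [hd, eval₂_C_mul_T] at m0 m1
  rw [one_zpow, Units.val_one, mul_one] at m1
  have hM10 := (lift_glue_entries hc' t ht (φ (d K α β γ))).1
  have hN10 := (lift_glue_entries hc' t ht (φ (u K α β γ))).1
  have hpair := (isPair_d_u.map φ.toAlgHom).map (lift (isPair_glue hc' t ht))
  have hcomm := smul_commutator_eq (adjoin_map_eq_top φ) (lift (isPair_glue hc' t ht))
    (((t ^ n : Sˣ) : S) ^ 2 - algebraMap K S α * (t ^ n : Sˣ) - algebraMap K S β)
  have hκu : IsUnit (algebraMap K S κ) := (IsUnit.mk0 _ hκ).map _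
  set M := lift (isPair_glue hc' t ht) (φ (d K α β γ)) with hM
  set N := lift (isPair_glue hc' t ht) (φ (u K α β γ)) with hN
  replace hpair : IsPair α β γ M N := hpair
  set τ : S := ((t ^ n : Sˣ) : S)
  have hyx : M 0 0 * N 0 1 + M 0 1 * N 1 1 = τ * (N 0 0 * M 0 1 + N 0 1 * M 1 1) := by
    refine hκu.mul_left_cancel ?_
    rw [m0] at mn0 ⊢
    rw [m1] at mn1 ⊢
    linear_combination M 0 1 * (mn1 - mn0)
  have hx : (τ ^ 2 - algebraMap K S α * τ - algebraMap K S β) *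
      (N 0 0 * M 0 1 + N 0 1 * M 1 1) = 0 := by
    refine hκu.mul_right_eq_zero.1 ?_
    have h := congrFun (congrFun hpair.ddu 0) 1
    simp only [Matrix.mul_apply, Fin.sum_univ_two, Matrix.add_apply, Matrix.smul_apply,
      hM10, hN10] at h
    simp only [Algebra.smul_def] at h
    have hc1 := congrArg (algebraMap K S) hc
    simp only [map_add, map_mul] at hc1
    rw [m0, m1] at h hyx
    rw [m0] at mn0
    rw [m1] at mn1 ⊢
    linear_combination h - algebraMap K S κ * (τ - algebraMap K S α) * hyx - M 0 1 * mn1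
      + (algebraMap K S α + algebraMap K S β) * M 0 1 * mn0 + M 0 1 * hc1
  have he : τ ^ 2 - algebraMap K S α * τ - algebraMap K S β = 0 := by
    have h1 := hcomm ?_ (d K α' β' γ') (u K α' β' γ')
    · have h2 := congrFun (congrFun h1 0) 1
      simp only [lift_d, lift_u, Matrix.mul_apply, Fin.sum_univ_two, Matrix.smul_apply,
        smul_eq_mul] at h2
      simp at h2
      have hu : IsUnit ((t : S) - 1) := by
        refine isUnit_of_mul_isUnit_left (y := t + 1 - algebraMap K S α') ?_
        have : IsUnit (algebraMap K S (1 - α' - β')) := (IsUnit.mk0 _ hne').map _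
        convert this.neg using 1
        simp only [map_sub, map_one]
        linear_combination ht
      refine hu.mul_left_eq_zero.1 ?_
      linear_combination h2
    · ext i j
      fin_cases i <;> fin_cases j <;> simp [Matrix.mul_apply, hM10, hN10]
      · ring
      · linear_combination (τ - 1) * hx +
          (τ ^ 2 - algebraMap K S α * τ - algebraMap K S β) * hyx
      · ring
  rcases hn with rfl | rfl
  · left
    refine eq_of_root ht hind (e := 1) ?_ one_ne_zero
    rw [map_one, one_mul]
    simpa [τ] using he
  · right
    refine eq_inv_of_root hβ ht hind (e := 1) ?_ one_ne_zero
    have hτ : (t : S) * τ = 1 := by simp [τ]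
    rw [map_one]
    linear_combination -(t : S) ^ 2 * he + (t * τ + 1 - algebraMap K S α * t) * hτ

end Hyperbola

section SkewLaurent

open SkewMonoidAlgebra

variable {R G : Type} [CommRing R] [CommGroup G] [LinearOrder G] [IsOrderedMonoid G]
  [MulSemiringAction G R]

theorem coeff_mul_of_unique {z D : SkewMonoidAlgebra R G} {a b : G}
    (h : ∀ a' ∈ z.support, ∀ b' ∈ D.support, a' * b' = a * b → a' = a) :
    (z * D).coeff (a * b) = z.coeff a * a • D.coeff b := by
  rw [coeff_mul, sum_def', Finset.sum_eq_single a]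
  · rw [sum_def', Finset.sum_eq_single b]
    · simp
    · intro b' _ hb'
      simp [hb']
    · intro hb
      simp [Finsupp.notMem_support_iff.1 hb]
  · intro a' ha' hne
    rw [sum_def']
    refine Finset.sum_eq_zero fun b' hb' => if_neg fun he => hne (h a' ha' b' hb' he)
  · intro ha
    rw [sum_def']
    refine Finset.sum_eq_zero fun b' _ => ?_
    simp [Finsupp.notMem_support_iff.1 ha]

variable [IsDomain R]

/-- An element intertwined with a homogeneous element is homogeneous of the same degree. -/
theorem exists_eq_single_of_mul_eq {z D : SkewMonoidAlgebra R G} {j : G} {h : R} (hz : z ≠ 0)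
    (he : z * D = single j h * z) : ∃ f, D = single j f := by
  by_cases hD : D = 0
  · exact ⟨0, by rw [hD, single_zero]⟩
  have hzs : z.support.Nonempty := Finset.nonempty_iff_ne_empty.2 (mt support_eq_empty.1 hz)
  have hDs : D.support.Nonempty := Finset.nonempty_iff_ne_empty.2 (mt support_eq_empty.1 hD)
  have key : ∀ a ∈ z.support, ∀ b ∈ D.support,
      (∀ a' ∈ z.support, ∀ b' ∈ D.support, a' * b' = a * b → a' = a) →
        j⁻¹ * (a * b) ∈ z.support := by
    intro a ha b hb hu
    have h1 : (z * D).coeff (a * b) ≠ 0 := by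
      rw [coeff_mul_of_unique hu]
      exact mul_ne_zero (mem_support_iff.1 ha)
        ((smul_ne_zero_iff_ne a).2 (mem_support_iff.1 hb))
    rw [he, coeff_single_mul] at h1
    refine mem_support_iff.2 fun h0 => h1 ?_
    rw [h0, smul_zero, mul_zero]
  have htop := key _ (z.support.max'_mem hzs) _ (D.support.max'_mem hDs) fun a' ha' b' hb' e =>
    ((mul_eq_mul_iff_eq_and_eq (z.support.le_max' _ ha') (D.support.le_max' _ hb')).1 e).1
  have hbot := key _ (z.support.min'_mem hzs) _ (D.support.min'_mem hDs) fun a' ha' b' hb' e =>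
    ((mul_eq_mul_iff_eq_and_eq (z.support.min'_le _ ha') (D.support.min'_le _ hb')).1 e.symm).1.symm
  have h1 : D.support.max' hDs ≤ j := by
    have := z.support.le_max' _ htop
    rwa [inv_mul_le_iff_le_mul, mul_comm j, mul_le_mul_iff_left] at this
  have h2 : j ≤ D.support.min' hDs := by
    have := z.support.min'_le _ hbot
    rwa [le_inv_mul_iff_mul_le, mul_comm j, mul_le_mul_iff_left] at this
  refine ⟨D.coeff j, SkewMonoidAlgebra.ext fun m => ?_⟩
  by_cases hm : m = j
  · simp [hm]
  · rw [coeff_single, Finsupp.single_eq_of_ne hm]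
    refine notMem_support_iff.1 fun hmem => hm (le_antisymm ?_ ?_)
    · exact (D.support.le_max' _ hmem).trans h1
    · exact h2.trans (D.support.min'_le _ hmem)

/-- A normal element for which the degree zero element `x` has distinct weights is homogeneous. -/
theorem exists_eq_single_of_normal {z X : SkewMonoidAlgebra R G} {x : R}
    (hx : ∀ g : G, g • x = x → g = 1) (hz : z ≠ 0) (he : z * X = single 1 x * z) :
    ∃ m r, r ≠ 0 ∧ z = single m r := by
  obtain ⟨f, rfl⟩ := exists_eq_single_of_mul_eq hz he
  have hw : ∀ m ∈ z.support, m • f = x := by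
    intro m hm
    have h := congrArg (fun w => w.coeff m) he
    simp only [coeff_mul_single_one, coeff_single_one_mul] at h
    refine mul_left_cancel₀ (mem_support_iff.1 hm) (h.trans (mul_comm _ _))
  obtain ⟨m, hm⟩ := Finset.nonempty_iff_ne_empty.2 (mt support_eq_empty.1 hz)
  refine ⟨m, z.coeff m, mem_support_iff.1 hm, SkewMonoidAlgebra.ext fun n => ?_⟩
  by_cases hn : n = m
  · simp [hn]
  · rw [coeff_single, Finsupp.single_eq_of_ne hn]
    refine notMem_support_iff.1 fun hmem => hn ?_
    have h : (n * m⁻¹) • x = x := by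
      rw [← hw m hm, smul_smul, inv_mul_cancel_right, hw n hmem, hw m hm]
    exact mul_inv_eq_one.1 (hx _ h)

end SkewLaurent

section Weight

variable {K : Type} [Field K] {β γ s r : K} {B : Type*} [Ring B] [Algebra K B] {D U : B}

/-- An element of the down-up algebra shifted by `γ` under conjugation by `d`. -/
def shiftElt (β γ s r : K) (D U : B) : B :=
  D * U + β • (U * D) - (s * γ ^ 2 + r * γ) • (1 : B)

/-- An element of the down-up algebra scaled by `-β` under conjugation by `d`. -/
def scaleElt (β γ s r : K) (D U : B) : B :=
  U * D - s • shiftElt β γ s r D U ^ 2 - r • shiftElt β γ s r D U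

theorem mul_eq_scaleElt :
    U * D = scaleElt β γ s r D U + s • shiftElt β γ s r D U ^ 2 +
      r • shiftElt β γ s r D U := by
  rw [scaleElt]
  abel

theorem mul_eq_shift_scaleElt (hs : s * (1 + β) = 0) (hr : r * (1 + β) + 2 * s * γ = 1) :
    D * U = -β • scaleElt β γ s r D U + s • (shiftElt β γ s r D U + γ • 1) ^ 2 +
      r • (shiftElt β γ s r D U + γ • 1) := by
  have h1 : D * U = shiftElt β γ s r D U - β • (U * D) + (s * γ ^ 2 + r * γ) • (1 : B) := by
    rw [shiftElt]
    abel
  rw [h1, scaleElt]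
  generalize shiftElt β γ s r D U = V
  have e : (V + γ • 1) ^ 2 = V ^ 2 + (2 * γ) • V + (γ ^ 2) • (1 : B) := by
    simp only [sq, mul_add, add_mul, mul_smul_comm, smul_mul_assoc, mul_one, one_mul]
    module
  rw [e]
  have hs' : s * β = -s := by linear_combination hs
  match_scalars
  · linear_combination -hr
  · ring
  · ring
  · linear_combination -hs

namespace IsPair

variable (h : IsPair (1 - β) β γ D U)

include h

theorem mul_shiftElt :
    D * shiftElt β γ s r D U = (shiftElt β γ s r D U + γ • 1) * D := by
  have h1 := h.ddu
  simp only [shiftElt, mul_add, mul_sub, add_mul, sub_mul, mul_smul_comm, smul_mul_assoc, mul_one,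
    one_mul, ← mul_assoc, h1]
  module

theorem shiftElt_mul :
    shiftElt β γ s r D U * U = U * (shiftElt β γ s r D U + γ • 1) := by
  have h1 := h.duu
  simp only [shiftElt, mul_add, mul_sub, add_mul, sub_mul, mul_smul_comm, smul_mul_assoc, mul_one,
    one_mul, ← mul_assoc, h1]
  module

theorem commute_mul : Commute (U * D) (D * U) := by
  have h1 := h.ddu
  have h2 := h.duu
  have e1 : U * D * (D * U) = U * (D * D * U) := by simp only [mul_assoc]
  have e2 : D * U * (U * D) = (D * U * U) * D := by simp only [mul_assoc]
  rw [Commute, SemiconjBy, e1, e2, h1, h2]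
  simp only [mul_add, add_mul, mul_smul_comm, smul_mul_assoc, ← mul_assoc]

theorem commute_scaleElt_shiftElt :
    Commute (scaleElt β γ s r D U) (shiftElt β γ s r D U) := by
  have h1 : Commute (U * D) (shiftElt β γ s r D U) :=
    ((h.commute_mul.add_right ((Commute.refl _).smul_right β))).sub_right
      ((Commute.one_right _).smul_right _)
  exact (h1.sub_left (((Commute.refl _).pow_left 2).smul_left s)).sub_left
    ((Commute.refl _).smul_left r)

theorem mul_scaleElt (hs : s * (1 + β) = 0) (hr : r * (1 + β) + 2 * s * γ = 1) :
    D * scaleElt β γ s r D U = -β • (scaleElt β γ s r D U * D) := by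
  have h1 := h.mul_shiftElt (s := s) (r := r)
  have h2 := mul_eq_shift_scaleElt (D := D) (U := U) hs hr
  have h3 : D * shiftElt β γ s r D U ^ 2 = (shiftElt β γ s r D U + γ • 1) ^ 2 * D := by
    rw [sq, ← mul_assoc, h1, mul_assoc, h1, ← mul_assoc, ← sq]
  conv_lhs => rw [scaleElt, mul_sub, mul_sub, ← mul_assoc, mul_smul_comm, mul_smul_comm, h3, h1, h2]
  simp only [add_mul, smul_mul_assoc]
  abel

theorem scaleElt_mul (hs : s * (1 + β) = 0) (hr : r * (1 + β) + 2 * s * γ = 1) :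
    scaleElt β γ s r D U * U = -β • (U * scaleElt β γ s r D U) := by
  have h1 := h.shiftElt_mul (s := s) (r := r)
  have h2 := mul_eq_shift_scaleElt (D := D) (U := U) hs hr
  have h3 : shiftElt β γ s r D U ^ 2 * U = U * (shiftElt β γ s r D U + γ • 1) ^ 2 := by
    rw [sq, mul_assoc, h1, ← mul_assoc, h1, mul_assoc, ← sq]
  conv_lhs => rw [scaleElt, sub_mul, sub_mul, mul_assoc, smul_mul_assoc, smul_mul_assoc, h3, h1, h2]
  simp only [mul_add, mul_smul_comm]
  abel

end IsPair

end Weight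

section WeightRing

open Polynomial

variable {K : Type} [Field K]

/-- The endomorphism of `K[v][p]` scaling `p` and shifting `v`. -/
def shiftScale (m e : K) : K[X][X] →ₐ[K] K[X][X] :=
  eval₂AlgHom (aeval (C (X + C e))) (C (C m) * X) fun _ => Commute.all _ _

theorem shiftScale_C_X (m e : K) : shiftScale m e (C X) = C (X + C e) := by
  simp [shiftScale]

theorem shiftScale_X (m e : K) : shiftScale m e X = C (C m) * X := by
  simp [shiftScale]

theorem algHom_ext_bivariate {S : Type*} [Ring S] [Algebra K S] {f g : K[X][X] →ₐ[K] S}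
    (hv : f (C X) = g (C X)) (hp : f X = g X) : f = g := by
  refine AlgHom.coe_ringHom_injective (Polynomial.ringHom_ext' ?_ hp)
  refine Polynomial.ringHom_ext' ?_ hv
  ext a
  exact (f.commutes a).trans (g.commutes a).symm

theorem shiftScale_comp {m n e e' : K} (hm : m * n = 1) (he : e + e' = 0) :
    (shiftScale m e).comp (shiftScale n e') = AlgHom.id K _ := by
  apply algHom_ext_bivariate
  · have h1 : (shiftScale m e) (C (C e')) = C (C e') := (shiftScale m e).commutes e'
    simp only [AlgHom.comp_apply, shiftScale_C_X, AlgHom.id_apply, map_add, h1]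
    rw [add_assoc, ← map_add C, ← map_add C, ← map_add C, he, C_0, add_zero]
  · have h1 : (shiftScale m e) (C (C n)) = C (C n) := (shiftScale m e).commutes n
    simp only [AlgHom.comp_apply, shiftScale_X, AlgHom.id_apply, map_mul, h1]
    rw [← mul_assoc, ← map_mul C, ← map_mul C, mul_comm n, hm]
    simp

/-- `shiftScale` as an automorphism. -/
def shiftScaleEquiv {m : K} (hm : m ≠ 0) (e : K) : K[X][X] ≃ₐ[K] K[X][X] :=
  AlgEquiv.ofAlgHom (shiftScale m e) (shiftScale m⁻¹ (-e))
    (shiftScale_comp (mul_inv_cancel₀ hm) (add_neg_cancel e))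
    (shiftScale_comp (inv_mul_cancel₀ hm) (neg_add_cancel e))

theorem exists_action {m : K} (hm : m ≠ 0) (e : K) :
    ∃ (_ : MulSemiringAction (Multiplicative ℤ) K[X][X])
      (_ : SMulCommClass (Multiplicative ℤ) K K[X][X]),
      ∀ q : K[X][X], Multiplicative.ofAdd (1 : ℤ) • q = shiftScale m e q := by
  let act : MulSemiringAction (Multiplicative ℤ) K[X][X] :=
    MulSemiringAction.compHom _ (zpowersHom _ (shiftScaleEquiv hm e))
  have hact : ∀ (g : Multiplicative ℤ) (q : K[X][X]),
      g • q = (zpowersHom _ (shiftScaleEquiv hm e) g) q := fun _ _ => rfl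
  refine ⟨act, ⟨fun g a q => ?_⟩, fun q => ?_⟩
  · rw [hact, hact, map_smul]
  · rw [hact]
    simp [shiftScaleEquiv]

theorem coeff_shiftScale (m e : K) (q : K[X][X]) (n : ℕ) :
    (shiftScale m e q).coeff n = C (m ^ n) * taylor e (q.coeff n) := by
  have h : shiftScale m e =
      (AlgHom.restrictScalars K (aeval (R := K[X]) (C (C m) * X : K[X][X]))).comp
        (mapAlgHom (taylorAlgHom e)) := by
    apply algHom_ext_bivariate
    · simp only [AlgHom.comp_apply, AlgHom.restrictScalars_apply, coe_mapAlgHom, shiftScale_C_X,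
        map_C, RingHom.coe_coe]
      rw [aeval_C, ← taylor_X]
      rfl
    · simp [shiftScale_X]
  rw [h]
  simp only [AlgHom.comp_apply, AlgHom.restrictScalars_apply, coe_mapAlgHom]
  rw [← comp_eq_aeval, comp_C_mul_X_coeff, coeff_map, ← C_pow, mul_comm]
  rfl

theorem eq_C_of_taylor_eq [CharZero K] {e : K} (he : e ≠ 0) {q : K[X]} (h : taylor e q = q) :
    q = C (q.coeff 0) := by
  have key : ∀ k : ℕ, q.eval (k * e) = q.coeff 0 := by
    intro k
    induction k with
    | zero => simp [coeff_zero_eq_eval_zero]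
    | succ k ih =>
      rw [← ih, ← congrArg (eval (k * e)) h, taylor_eval]
      congr 1
      push_cast
      ring
  refine eq_of_infinite_eval_eq _ _ (Set.infinite_of_injective_forall_mem
    (f := fun k : ℕ => (k : K) * e) (fun a b hab => ?_) fun k => ?_)
  · exact_mod_cast mul_right_cancel₀ he hab
  · simp [key]

/-- The semi-invariants of `shiftScale` are eigenvectors which do not involve `v`. -/
theorem exists_eq_map_C_of_shiftScale_eq_mul [CharZero K] {m e : K} (hm : m ≠ 0) (he : e ≠ 0)
    {q f : K[X][X]} (hq : q ≠ 0) (h : shiftScale m e q = q * f) :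
    ∃ (g : K[X]) (a : K), q = g.map C ∧ g.comp (C m * X) = a • g := by
  have hdeg : (shiftScale m e q).natDegree = q.natDegree := by
    refine natDegree_eq_of_le_of_coeff_ne_zero ?_ ?_
    · refine natDegree_le_iff_coeff_eq_zero.2 fun n hn => ?_
      rw [coeff_shiftScale, coeff_eq_zero_of_natDegree_lt hn, map_zero, mul_zero]
    · rw [coeff_shiftScale]
      refine mul_ne_zero (C_ne_zero.2 (pow_ne_zero _ hm)) ?_
      rwa [Ne, taylor_eq_zero, coeff_natDegree, leadingCoeff_eq_zero]
  have hf : f ≠ 0 := by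
    rintro rfl
    rw [mul_zero] at h
    rw [h, natDegree_zero] at hdeg
    have h0 := congrArg (fun p => coeff p 0) h
    rw [coeff_shiftScale, coeff_zero, pow_zero, C_1, one_mul, taylor_eq_zero] at h0
    rw [eq_C_of_natDegree_eq_zero hdeg.symm, h0, C_0] at hq
    exact hq rfl
  obtain ⟨g, rfl⟩ : ∃ g, f = C g := by
    rw [h, natDegree_mul hq hf] at hdeg
    exact ⟨_, eq_C_of_natDegree_eq_zero (by omega)⟩
  have hcoeff : ∀ n, C (m ^ n) * taylor e (q.coeff n) = q.coeff n * g := by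
    intro n
    rw [← coeff_shiftScale, h, coeff_mul_C]
  have hg : g ≠ 0 := fun hg => hf (by rw [hg, C_0])
  obtain ⟨a, rfl⟩ : ∃ a, g = C a := by
    have h1 := congrArg natDegree (hcoeff q.natDegree)
    rw [natDegree_C_mul (pow_ne_zero _ hm), natDegree_taylor, coeff_natDegree,
      natDegree_mul (leadingCoeff_ne_zero.2 hq) hg] at h1
    exact ⟨_, eq_C_of_natDegree_eq_zero (by omega)⟩
  have hpow : ∀ n, q.coeff n = 0 ∨ m ^ n = a := by
    intro n
    by_cases h0 : q.coeff n = 0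
    · exact Or.inl h0
    · have h1 := congrArg leadingCoeff (hcoeff n)
      rw [leadingCoeff_mul, leadingCoeff_mul, leadingCoeff_C, leadingCoeff_C, leadingCoeff_taylor,
        mul_comm] at h1
      exact Or.inr (mul_left_cancel₀ (leadingCoeff_ne_zero.2 h0) h1)
  refine ⟨q.map (evalRingHom 0), a, ?_, ?_⟩
  · ext1 n
    rw [coeff_map, coeff_map, coe_evalRingHom, ← coeff_zero_eq_eval_zero]
    refine eq_C_of_taylor_eq he ?_
    rcases hpow n with h0 | h1
    · rw [h0, map_zero]
    · have h2 := hcoeff n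
      rw [h1, mul_comm] at h2
      exact mul_right_cancel₀ hg h2
  · ext n
    rw [comp_C_mul_X_coeff, coeff_smul, coeff_map, smul_eq_mul]
    rcases hpow n with h0 | h1
    · simp [h0]
    · rw [h1, mul_comm]

end WeightRing

section SkewPair

open SkewMonoidAlgebra

variable {K : Type} [Field K] {α β γ : K} {R G : Type} [CommRing R] [Algebra K R] [CommGroup G]
  [MulSemiringAction G R] [SMulCommClass G K R]

theorem isPair_single {g : G} {x : R}
    (hx : g • g • x = α • g • x + β • x + algebraMap K R γ) :
    IsPair α β γ (single g 1 : SkewMonoidAlgebra R G) (single g⁻¹ x) where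
  ddu := by
    simp only [single_mul_single, smul_single, smul_one, mul_one, one_mul, mul_inv_cancel_right,
      inv_mul_cancel, mul_inv_cancel, ← single_add, mul_smul, hx]
    rw [Algebra.algebraMap_eq_smul_one]
  duu := by
    have h := congrArg (g⁻¹ • ·) hx
    simp only [smul_add, inv_smul_smul, smul_comm g⁻¹ α, smul_comm g⁻¹ β,
      Algebra.algebraMap_eq_smul_one, smul_comm g⁻¹ γ, smul_one] at h
    simp only [single_mul_single, smul_single, smul_one, mul_one, one_mul, inv_mul_cancel, mul_inv_cancel,
      inv_mul_cancel_right, ← single_add, one_smul, h]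
    congr 1
    simp only [add_mul, smul_mul_assoc, mul_comm x, one_mul]

end SkewPair

section Embedding

open SkewMonoidAlgebra Multiplicative

variable {K : Type} [Field K] {R : Type} [CommRing R] [Algebra K R] {B : Type*} [Ring B] [Algebra K B]
  {D U : B} {x : R} {ι : R →ₐ[K] B}

/-- The power of `D` or of `U` which is homogeneous of degree `n`. -/
def signedPow (D U : B) (g : Multiplicative ℤ) : B :=
  D ^ g.toAdd.toNat * U ^ (-g.toAdd).toNat

/-- The additive map which has all sums of `ι q * signedPow D U g` as its range. -/
def signedSum (D U : B) (ι : R →ₐ[K] B) : SkewMonoidAlgebra R (Multiplicative ℤ) →+ B where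
  toFun f := f.sum fun g q => ι q * signedPow D U g
  map_zero' := sum_zero_index
  map_add' f f' := sum_add_index' (by simp) (by simp [add_mul])

theorem signedSum_single (g : Multiplicative ℤ) (q : R) :
    signedSum D U ι (single g q) = ι q * signedPow D U g := by
  simp [signedSum, sum_single_index]

variable [MulSemiringAction (Multiplicative ℤ) R] [SMulCommClass (Multiplicative ℤ) K R]
  {θ : B →ₐ[K] SkewMonoidAlgebra R (Multiplicative ℤ)}

/-- The data identifying an algebra generated by `D` and `U` with the subalgebra of a skew
Laurent ring generated by `T` and `x T⁻¹`. -/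
structure IsSkewEmbedding (D U : B) (x : R) (ι : R →ₐ[K] B)
    (θ : B →ₐ[K] SkewMonoidAlgebra R (Multiplicative ℤ)) : Prop where
  adjoin : Algebra.adjoin K {D, U} = ⊤
  ne_zero : x ≠ 0
  mul_ι : ∀ q, D * ι q = ι (ofAdd (1 : ℤ) • q) * D
  ι_mul : ∀ q, ι q * U = U * ι (ofAdd (1 : ℤ) • q)
  ι_elt : ι x = U * D
  ι_smul_elt : ι (ofAdd (1 : ℤ) • x) = D * U
  map_D : θ D = single (ofAdd (1 : ℤ)) 1
  map_U : θ U = single (ofAdd (1 : ℤ))⁻¹ x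
  map_ι : ∀ q, θ (ι q) = single 1 q

namespace IsSkewEmbedding

variable (h : IsSkewEmbedding D U x ι θ)

include h

theorem exists_mul_signedPow (g : Multiplicative ℤ) :
    ∃ y g', D * signedPow D U g = ι y * signedPow D U g' := by
  obtain ⟨n, rfl⟩ := ofAdd.surjective g
  rcases le_or_gt 0 n with hn | hn
  · refine ⟨1, ofAdd (n + 1), ?_⟩
    have e1 : (n + 1).toNat = n.toNat + 1 := by omega
    have e2 : (-n).toNat = 0 := by omega
    have e3 : (-(n + 1)).toNat = 0 := by omega
    simp only [signedPow, toAdd_ofAdd, e1, e2, e3, pow_zero, mul_one, map_one, one_mul, pow_succ']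
  · refine ⟨ofAdd (1 : ℤ) • x, ofAdd (n + 1), ?_⟩
    have e1 : (n + 1).toNat = 0 := by omega
    have e2 : n.toNat = 0 := by omega
    have e3 : (-n).toNat = (-(n + 1)).toNat + 1 := by omega
    simp only [signedPow, toAdd_ofAdd, e1, e2, e3, pow_zero, one_mul, pow_succ', h.ι_smul_elt,
      mul_assoc]

theorem exists_mul_signedPow' (g : Multiplicative ℤ) :
    ∃ y g', U * signedPow D U g = ι y * signedPow D U g' := by
  obtain ⟨n, rfl⟩ := ofAdd.surjective g
  rcases le_or_gt n 0 with hn | hn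
  · refine ⟨1, ofAdd (n - 1), ?_⟩
    have e1 : (n - 1).toNat = 0 := by omega
    have e2 : n.toNat = 0 := by omega
    have e3 : (-(n - 1)).toNat = (-n).toNat + 1 := by omega
    simp only [signedPow, toAdd_ofAdd, e1, e2, e3, pow_zero, one_mul, map_one, pow_succ']
  · refine ⟨x, ofAdd (n - 1), ?_⟩
    have e1 : n.toNat = (n - 1).toNat + 1 := by omega
    have e2 : (-n).toNat = 0 := by omega
    have e3 : (-(n - 1)).toNat = 0 := by omega
    simp only [signedPow, toAdd_ofAdd, e1, e2, e3, pow_zero, mul_one, pow_succ', h.ι_elt,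
      mul_assoc]

theorem signedSum_surjective : Function.Surjective (signedSum D U ι) := by
  have hD : ∀ f, ∃ f', signedSum D U ι f' = D * signedSum D U ι f := by
    intro f
    induction f using SkewMonoidAlgebra.induction_on with
    | zero => exact ⟨0, by simp⟩
    | single g q =>
      obtain ⟨y, g', he⟩ := h.exists_mul_signedPow g
      refine ⟨single g' (ofAdd (1 : ℤ) • q * y), ?_⟩
      rw [signedSum_single, signedSum_single, ← mul_assoc, h.mul_ι, mul_assoc, he, map_mul,
        mul_assoc]
    | add a b ha hb =>
      obtain ⟨a', ha'⟩ := ha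
      obtain ⟨b', hb'⟩ := hb
      exact ⟨a' + b', by rw [map_add, map_add, ha', hb', mul_add]⟩
  have hU : ∀ f, ∃ f', signedSum D U ι f' = U * signedSum D U ι f := by
    intro f
    induction f using SkewMonoidAlgebra.induction_on with
    | zero => exact ⟨0, by simp⟩
    | single g q =>
      obtain ⟨y, g', he⟩ := h.exists_mul_signedPow' g
      refine ⟨single g' ((ofAdd (1 : ℤ))⁻¹ • q * y), ?_⟩
      have hq := h.ι_mul ((ofAdd (1 : ℤ))⁻¹ • q)
      rw [smul_inv_smul] at hq
      rw [signedSum_single, signedSum_single, ← mul_assoc, ← hq, mul_assoc, he, map_mul,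
        mul_assoc]
    | add a b ha hb =>
      obtain ⟨a', ha'⟩ := ha
      obtain ⟨b', hb'⟩ := hb
      exact ⟨a' + b', by rw [map_add, map_add, ha', hb', mul_add]⟩
  have key : ∀ b f, ∃ f', signedSum D U ι f' = b * signedSum D U ι f := by
    intro b
    refine induction_of_adjoin h.adjoin (p := fun b => ∀ f, ∃ f', signedSum D U ι f' =
      b * signedSum D U ι f) hD hU ?_ ?_ ?_ b
    · intro a f
      induction f using SkewMonoidAlgebra.induction_on with
      | zero => exact ⟨0, by simp⟩
      | single g q =>
        exact ⟨single g (algebraMap K R a * q), by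
          rw [signedSum_single, signedSum_single, map_mul, AlgHom.commutes, mul_assoc]⟩
      | add a b ha hb =>
        obtain ⟨a', ha'⟩ := ha
        obtain ⟨b', hb'⟩ := hb
        exact ⟨a' + b', by rw [map_add, map_add, ha', hb', mul_add]⟩
    · intro a b ha hb f
      obtain ⟨a', ha'⟩ := ha f
      obtain ⟨b', hb'⟩ := hb f
      exact ⟨a' + b', by rw [map_add, ha', hb', add_mul]⟩
    · intro a b ha hb f
      obtain ⟨b', hb'⟩ := hb f
      obtain ⟨a', ha'⟩ := ha b'
      exact ⟨a', by rw [ha', hb', mul_assoc]⟩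
  intro b
  obtain ⟨f, hf⟩ := key b (single 1 1)
  exact ⟨f, by rw [hf, signedSum_single]; simp [signedPow]⟩

variable [IsDomain R]

theorem exists_map_signedPow (g : Multiplicative ℤ) :
    ∃ w, w ≠ 0 ∧ θ (signedPow D U g) = single g w := by
  have hpos : ∀ n : ℕ, θ (D ^ n) = single (ofAdd (n : ℤ)) 1 := by
    intro n
    induction n with
    | zero => simp
    | succ n ih =>
      rw [pow_succ, map_mul, ih, h.map_D, single_mul_single, ← ofAdd_add]
      simp
  have hneg : ∀ n : ℕ, ∃ w, w ≠ 0 ∧ θ (U ^ n) = single (ofAdd (-n : ℤ)) w := by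
    intro n
    induction n with
    | zero => exact ⟨1, one_ne_zero, by simp⟩
    | succ n ih =>
      obtain ⟨w, hw, e⟩ := ih
      refine ⟨w * ofAdd (-n : ℤ) • x,
        mul_ne_zero hw ((smul_ne_zero_iff_ne _).2 h.ne_zero), ?_⟩
      rw [pow_succ, map_mul, e, h.map_U, single_mul_single, ← ofAdd_neg, ← ofAdd_add]
      congr 2
      push_cast
      ring
  obtain ⟨n, rfl⟩ := ofAdd.surjective g
  obtain ⟨w, hw, e⟩ := hneg (-n).toNat
  refine ⟨ofAdd (n.toNat : ℤ) • w, (smul_ne_zero_iff_ne _).2 hw, ?_⟩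
  rw [signedPow, map_mul, toAdd_ofAdd, hpos, e, single_mul_single, ← ofAdd_add, one_mul]
  congr 2
  omega

theorem coeff_map_signedSum {g : Multiplicative ℤ} {w : R}
    (hw : θ (signedPow D U g) = single g w) (f : SkewMonoidAlgebra R (Multiplicative ℤ)) :
    (θ (signedSum D U ι f)).coeff g = f.coeff g * w := by
  induction f using SkewMonoidAlgebra.induction_on with
  | zero => simp
  | single g' q =>
    obtain ⟨w', -, hw'⟩ := h.exists_map_signedPow g'
    rw [signedSum_single, map_mul, h.map_ι, hw', single_mul_single, one_mul, one_smul,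
      coeff_single_apply, coeff_single_apply]
    split_ifs with he
    · subst he
      rw [hw] at hw'
      have := congrArg (fun f => f.coeff g') hw'
      simp only [coeff_single, Finsupp.single_eq_same] at this
      rw [this]
    · rw [zero_mul]
  | add a b ha hb => simp [ha, hb, add_mul]

theorem injective : Function.Injective θ := by
  rw [injective_iff_map_eq_zero]
  intro b hb
  obtain ⟨f, rfl⟩ := h.signedSum_surjective b
  have hf : f = 0 := by
    refine SkewMonoidAlgebra.ext fun g => ?_
    obtain ⟨w, hw, e⟩ := h.exists_map_signedPow g
    have h1 := h.coeff_map_signedSum e f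
    rw [hb, coeff_zero, Finsupp.zero_apply] at h1
    rw [coeff_zero, Finsupp.zero_apply]
    exact (mul_eq_zero.1 h1.symm).resolve_right hw
  rw [hf, map_zero]

theorem character_apply {χ : B →ₐ[K] K} (hD : χ D = 0) (hU : χ U = 0) (b : B) :
    χ b = χ (ι ((θ b).coeff 1)) := by
  obtain ⟨f, rfl⟩ := h.signedSum_surjective b
  have h1 : θ (signedPow D U 1) = single 1 1 := by simp [signedPow]
  rw [h.coeff_map_signedSum h1, mul_one]
  clear h1
  induction f using SkewMonoidAlgebra.induction_on with
  | zero => simp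
  | single g q =>
    rw [signedSum_single, coeff_single_apply]
    split_ifs with he
    · subst he
      simp [signedPow]
    · obtain ⟨n, rfl⟩ := ofAdd.surjective g
      have hn : n ≠ 0 := fun h0 => he (by rw [h0]; rfl)
      rw [map_mul, signedPow, map_mul, map_pow, map_pow, hD, hU, map_zero, map_zero, toAdd_ofAdd]
      rcases lt_or_gt_of_ne hn with h0 | h0
      · rw [zero_pow (n := (-n).toNat) (by omega), mul_zero, mul_zero]
      · rw [zero_pow (n := n.toNat) (by omega), zero_mul, mul_zero]
  | add a b ha hb => simp [ha, hb]

end IsSkewEmbedding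

end Embedding

section WeightEmbedding

open Polynomial SkewMonoidAlgebra Multiplicative

variable {K : Type} [Field K] {β γ s r : K}

/-- The expression of `u * d` in terms of the scaled and the shifted element. -/
def profile (s r : K) : K[X][X] := X + s • C X ^ 2 + r • C X

theorem shiftScale_profile (m e : K) :
    shiftScale m e (profile s r) =
      m • X + s • (C X + e • 1) ^ 2 + r • (C X + e • 1) := by
  have h1 : (C (C e) : K[X][X]) = e • 1 := by
    rw [← C_1, ← C_1, smul_C, smul_C, smul_eq_mul, mul_one]
  have h2 : (C (C m) * X : K[X][X]) = m • X := (Algebra.smul_def m _).symm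
  simp only [profile, map_add, map_smul, map_pow, shiftScale_C_X, shiftScale_X, h1, h2]

theorem C_X_eq (hs : s * (1 + β) = 0) (hr : r * (1 + β) + 2 * s * γ = 1) :
    (C X : K[X][X]) = shiftScale (-β) γ (profile s r) + β • profile s r -
      (s * γ ^ 2 + r * γ) • (1 : K[X][X]) := by
  rw [shiftScale_profile, profile]
  generalize (C X : K[X][X]) = v
  have e : (v + γ • 1) ^ 2 = v ^ 2 + (2 * γ) • v + (γ ^ 2) • (1 : K[X][X]) := by
    simp only [sq, mul_add, add_mul, mul_smul_comm, smul_mul_assoc, mul_one, one_mul]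
    module
  rw [e]
  match_scalars
  · linear_combination -hr
  · ring
  · linear_combination -hs
  · ring

theorem shiftScale_shiftScale_profile (hs : s * (1 + β) = 0)
    (hr : r * (1 + β) + 2 * s * γ = 1) :
    shiftScale (-β) γ (shiftScale (-β) γ (profile s r)) =
      (1 - β) • shiftScale (-β) γ (profile s r) + β • profile s r + algebraMap K _ γ := by
  have h1 := C_X_eq hs hr
  have h2 := congrArg (shiftScale (-β) γ) h1
  rw [shiftScale_C_X, C_add, h1] at h2
  simp only [map_sub, map_add, map_smul, map_one] at h2
  have h3 : (C (C γ) : K[X][X]) = algebraMap K _ γ := rfl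
  rw [h3] at h2
  generalize shiftScale (-β) γ (profile s r) = y at *
  generalize shiftScale (-β) γ y = z at *
  rw [sub_smul, one_smul]
  linear_combination -h2

theorem profile_ne_zero : profile s r ≠ 0 := by
  intro h
  have := congrArg (fun p => Polynomial.coeff p 1) h
  rw [profile, ← C_pow, smul_C, smul_C] at this
  simp at this

variable {B : Type*} [Ring B] [Algebra K B] {D U : B}

/-- Evaluation of a polynomial in two variables at a commuting pair. -/
def evalPair {P V : B} (h : Commute P V) : K[X][X] →ₐ[K] B :=
  eval₂AlgHom (aeval V) P fun q => by
    induction q using Polynomial.induction_on' with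
    | add p q hp hq => rw [map_add]; exact hp.add_left hq
    | monomial n a =>
      rw [aeval_monomial]
      exact (Algebra.commute_algebraMap_left a P).mul_left (h.symm.pow_left n)

theorem evalPair_C_X {P V : B} (h : Commute P V) : evalPair (K := K) h (C X) = V := by
  simp [evalPair]

theorem evalPair_X {P V : B} (h : Commute P V) : evalPair (K := K) h X = P := by
  simp [evalPair]

theorem evalPair_map_C {P V : B} (h : Commute P V) (q : K[X]) :
    evalPair (K := K) h (q.map C) = aeval P q := by
  induction q using Polynomial.induction_on' with
  | add p q hp hq => rw [Polynomial.map_add, map_add, map_add, hp, hq]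
  | monomial n a =>
    rw [map_monomial, ← C_mul_X_pow_eq_monomial, map_mul, map_pow, evalPair_X, aeval_monomial]
    exact congrArg (· * P ^ n) ((evalPair (K := K) h).commutes a)

theorem induction_bivariate {p : K[X][X] → Prop} (hK : ∀ a, p (algebraMap K _ a)) (hv : p (C X))
    (hp : p X) (hadd : ∀ x y, p x → p y → p (x + y)) (hmul : ∀ x y, p x → p y → p (x * y))
    (q : K[X][X]) : p q := by
  have hC : ∀ c : K[X], p (C c) := by
    intro c
    induction c using Polynomial.induction_on with
    | C a => exact hK a
    | add c c' hc hc' => rw [C_add]; exact hadd _ _ hc hc'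
    | monomial n a h => rw [pow_succ, ← mul_assoc, C_mul]; exact hmul _ _ h hv
  induction q using Polynomial.induction_on with
  | C a => exact hC a
  | add c c' hc hc' => exact hadd _ _ hc hc'
  | monomial n a h => rw [pow_succ, ← mul_assoc]; exact hmul _ _ h hp

variable [MulSemiringAction (Multiplicative ℤ) K[X][X]]
  [SMulCommClass (Multiplicative ℤ) K K[X][X]]

theorem isSkewEmbedding (hs : s * (1 + β) = 0) (hr : r * (1 + β) + 2 * s * γ = 1)
    (hact : ∀ q : K[X][X], ofAdd (1 : ℤ) • q = shiftScale (-β) γ q)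
    (h : IsPair (1 - β) β γ D U) (hDU : Algebra.adjoin K {D, U} = ⊤)
    (θ : B →ₐ[K] SkewMonoidAlgebra K[X][X] (Multiplicative ℤ))
    (hD : θ D = single (ofAdd (1 : ℤ)) 1) (hU : θ U = single (ofAdd (1 : ℤ))⁻¹ (profile s r)) :
    IsSkewEmbedding D U (profile s r)
      (evalPair (h.commute_scaleElt_shiftElt (s := s) (r := r))) θ := by
  set ι := evalPair (K := K) (h.commute_scaleElt_shiftElt (s := s) (r := r))
  have hv : ι (C X) = shiftElt β γ s r D U := evalPair_C_X _
  have hp : ι X = scaleElt β γ s r D U := evalPair_X _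
  have hx : ι (profile s r) = U * D := by
    simp only [profile, map_add, map_smul, map_pow, hv, hp]
    exact mul_eq_scaleElt.symm
  have hσx : ι (shiftScale (-β) γ (profile s r)) = D * U := by
    simp only [shiftScale_profile, map_add, map_smul, map_pow, map_one, hv, hp]
    exact (mul_eq_shift_scaleElt hs hr).symm
  have hUD : θ (U * D) = single 1 (profile s r) := by
    rw [map_mul, hU, hD, single_mul_single, inv_mul_cancel, smul_one, mul_one]
  have hDU' : θ (D * U) = single 1 (shiftScale (-β) γ (profile s r)) := by
    rw [map_mul, hU, hD, single_mul_single, mul_inv_cancel, hact, one_mul]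
  have hθv : θ (shiftElt β γ s r D U) = single 1 (C X) := by
    rw [C_X_eq hs hr, shiftElt, map_sub, map_add, map_smul, map_smul, map_one, hUD, hDU']
    simp only [sub_eq_add_neg, single_add, single_neg, ← smul_single, single_one_one]
  have hθp : θ (scaleElt β γ s r D U) = single 1 X := by
    have : (X : K[X][X]) = profile s r - s • C X ^ 2 - r • C X := by
      rw [profile]
      abel
    rw [this, scaleElt, map_sub, map_sub, map_smul, map_smul, map_pow, hUD, hθv]
    simp only [sub_eq_add_neg, single_add, single_neg, ← smul_single, sq, single_mul_single,
      one_smul, one_mul]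
  have hC : ι (C (C (-β)) * X) = -β • scaleElt β γ s r D U := by
    rw [← hp, ← map_smul]
    exact congrArg ι (Algebra.smul_def (-β) (X : K[X][X])).symm
  refine ⟨hDU, profile_ne_zero, fun q => ?_, fun q => ?_, hx, by rw [hact, hσx], hD, hU,
    fun q => ?_⟩
  · rw [hact]
    induction q using induction_bivariate with
    | hK a => simp only [AlgHom.commutes]; exact (Algebra.commutes a D).symm
    | hv =>
      rw [shiftScale_C_X, C_add, map_add, hv, h.mul_shiftElt, ← Algebra.algebraMap_eq_smul_one]
      exact congrArg (fun t => (shiftElt β γ s r D U + t) * D) (ι.commutes γ).symm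
    | hp =>
      rw [shiftScale_X, hp, h.mul_scaleElt hs hr, hC, smul_mul_assoc]
    | hadd a b ha hb => rw [map_add, mul_add, ha, hb, map_add, map_add, add_mul]
    | hmul a b ha hb => rw [map_mul, ← mul_assoc, ha, mul_assoc, hb, map_mul, map_mul, mul_assoc]
  · rw [hact]
    induction q using induction_bivariate with
    | hK a => simp only [AlgHom.commutes]; exact (Algebra.commutes a U)
    | hv =>
      rw [shiftScale_C_X, C_add, map_add, hv, h.shiftElt_mul, ← Algebra.algebraMap_eq_smul_one]
      exact congrArg (fun t => U * (shiftElt β γ s r D U + t)) (ι.commutes γ).symm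
    | hp =>
      rw [shiftScale_X, hp, h.scaleElt_mul hs hr, hC, mul_smul_comm]
    | hadd a b ha hb => rw [map_add, add_mul, ha, hb, map_add, map_add, mul_add]
    | hmul a b ha hb => rw [map_mul, mul_assoc, hb, ← mul_assoc, ha, map_mul, map_mul, mul_assoc]
  · induction q using induction_bivariate with
    | hK a => simp only [Algebra.algebraMap_eq_smul_one, map_smul, map_one, ← smul_single,
        single_one_one]
    | hv => rw [hv, hθv]
    | hp => rw [hp, hθp]
    | hadd a b ha hb => rw [map_add, map_add, ha, hb, single_add]
    | hmul a b ha hb => rw [map_mul, map_mul, ha, hb, single_mul_single, one_smul, one_mul]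

end WeightEmbedding

section NormalElements

open Polynomial SkewMonoidAlgebra Multiplicative

variable {K : Type} [Field K] {α β γ s r : K}

/-- The character annihilating both generators. -/
def counit (α β γ : K) : DownUp K α β γ →ₐ[K] K :=
  lift (D := 0) (U := 0) ⟨by simp, by simp⟩

@[simp]
theorem counit_d : counit α β γ (d K α β γ) = 0 := lift_d _

@[simp]
theorem counit_u : counit α β γ (u K α β γ) = 0 := lift_u _

theorem ofAdd_smul_C_X [MulSemiringAction (Multiplicative ℤ) K[X][X]]
    (hact : ∀ q : K[X][X], ofAdd (1 : ℤ) • q = shiftScale (-β) γ q) (n : ℕ) :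
    ofAdd (n : ℤ) • (C X : K[X][X]) = C (X + C (n * γ)) := by
  induction n with
  | zero => simp
  | succ n ih =>
    have h1 : shiftScale (-β) γ (C (C (n * γ))) = C (C (n * γ)) :=
      (shiftScale (-β) γ).commutes _
    rw [Nat.cast_succ, add_comm, ofAdd_add, mul_smul, ih, hact, C_add, map_add, h1,
      shiftScale_C_X, ← C_add, add_assoc, ← C_add]
    congr 4
    push_cast
    ring

theorem eq_one_of_smul_profile [CharZero K] [MulSemiringAction (Multiplicative ℤ) K[X][X]]
    [SMulCommClass (Multiplicative ℤ) K K[X][X]] (hγ : γ ≠ 0)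
    (hs : s * (1 + β) = 0) (hr : r * (1 + β) + 2 * s * γ = 1)
    (hact : ∀ q : K[X][X], ofAdd (1 : ℤ) • q = shiftScale (-β) γ q)
    {g : Multiplicative ℤ} (hg : g • profile s r = profile s r) : g = 1 := by
  have key : ∀ n : ℕ, ofAdd (n : ℤ) • profile s r = profile s r → n = 0 := by
    intro n hn
    have h1 : ofAdd (n : ℤ) • (C X : K[X][X]) = C X := by
      rw [C_X_eq hs hr, smul_sub, smul_add, smul_comm _ β, smul_comm _ (s * γ ^ 2 + r * γ),
        smul_one, hn, ← hact, smul_smul, mul_comm, mul_smul, hn]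
    rw [ofAdd_smul_C_X hact] at h1
    have h2 := C_injective h1
    rw [add_eq_left, C_eq_zero] at h2
    exact_mod_cast (mul_eq_zero.1 h2).resolve_right hγ
  obtain ⟨k, rfl⟩ := ofAdd.surjective g
  obtain ⟨n, rfl | rfl⟩ := k.eq_nat_or_neg
  · rw [key n hg]
    rfl
  · rw [ofAdd_neg, inv_smul_eq_iff] at hg
    rw [key n hg.symm]
    rfl

theorem exists_isSkewEmbedding (hβ : β ≠ 0) (hs : s * (1 + β) = 0)
    (hr : r * (1 + β) + 2 * s * γ = 1) :
    ∃ (_ : MulSemiringAction (Multiplicative ℤ) K[X][X])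
      (_ : SMulCommClass (Multiplicative ℤ) K K[X][X])
      (θ : DownUp K (1 - β) β γ →ₐ[K] SkewMonoidAlgebra K[X][X] (Multiplicative ℤ)),
      (∀ q : K[X][X], ofAdd (1 : ℤ) • q = shiftScale (-β) γ q) ∧
        IsSkewEmbedding (d K (1 - β) β γ) (u K (1 - β) β γ) (profile s r)
          (evalPair (isPair_d_u.commute_scaleElt_shiftElt (s := s) (r := r))) θ := by
  obtain ⟨act, hcomm, hact⟩ := exists_action (neg_ne_zero.2 hβ) γ
  have hpair : IsPair (1 - β) β γ (single (ofAdd (1 : ℤ)) 1 : SkewMonoidAlgebra K[X][X] _)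
      (single (ofAdd (1 : ℤ))⁻¹ (profile s r)) := by
    apply isPair_single
    rw [hact, hact]
    exact shiftScale_shiftScale_profile hs hr
  exact ⟨act, hcomm, lift hpair, hact,
    isSkewEmbedding hs hr hact isPair_d_u adjoin_eq_top (lift hpair) (lift_d _) (lift_u _)⟩

theorem eq_zero_of_aeval_scaleElt_mul_eq_zero (hβ : β ≠ 0) (hs : s * (1 + β) = 0)
    (hr : r * (1 + β) + 2 * s * γ = 1) {q : K[X]}
    (hq : aeval (scaleElt β γ s r (d K (1 - β) β γ) (u K (1 - β) β γ)) q * d K (1 - β) β γ = 0) :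
    q = 0 := by
  obtain ⟨act, hcomm, θ, -, h⟩ := exists_isSkewEmbedding hβ hs hr
  have h1 := congrArg θ hq
  rw [← evalPair_map_C (isPair_d_u.commute_scaleElt_shiftElt), map_mul, h.map_ι, h.map_D,
    single_mul_single, smul_one, mul_one, map_zero, single_eq_zero] at h1
  exact (Polynomial.map_eq_zero_iff C_injective).1 h1

/-- A normal element with nonzero constant term is a polynomial in the scaled element. -/
theorem exists_eq_aeval_of_normal [CharZero K] (hβ : β ≠ 0) (hγ : γ ≠ 0)
    (hs : s * (1 + β) = 0) (hr : r * (1 + β) + 2 * s * γ = 1) {z : DownUp K (1 - β) β γ}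
    (hz : counit _ _ _ z ≠ 0) (hn : ∀ a, ∃ b, a * z = z * b) :
    ∃ (q : K[X]) (a : K),
      z = aeval (scaleElt β γ s r (d K (1 - β) β γ) (u K (1 - β) β γ)) q ∧
        q.comp (C (-β) * X) = a • q := by
  obtain ⟨act, hcomm, θ, hact, h⟩ := exists_isSkewEmbedding hβ hs hr
  have hz0 : θ z ≠ 0 := by
    rw [Ne, map_eq_zero_iff θ h.injective]
    rintro rfl
    exact hz (map_zero _)
  obtain ⟨b, hb⟩ := hn (u K _ _ _ * d K _ _ _)
  obtain ⟨m, f, hf, hzf⟩ := exists_eq_single_of_normal (x := profile s r) (X := θ b)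
    (fun g hg => eq_one_of_smul_profile hγ hs hr hact hg) hz0 (by
      rw [← map_mul, ← hb, map_mul, ← h.ι_elt, h.map_ι])
  have hc := h.character_apply (χ := counit _ _ _) counit_d counit_u z
  obtain rfl : m = 1 := by
    by_contra hm
    rw [hzf, coeff_single_apply, if_neg (fun h => hm (by rw [h])), map_zero, map_zero] at hc
    exact hz hc
  obtain ⟨c, hdc⟩ := hn (d K _ _ _)
  have h1 : θ z * θ c = single (ofAdd (1 : ℤ)) 1 * θ z := by
    rw [← map_mul, ← hdc, map_mul, h.map_D]
  obtain ⟨w, hw⟩ := exists_eq_single_of_mul_eq hz0 h1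
  rw [hw, hzf, single_mul_single, single_mul_single, one_mul, mul_one, one_mul, one_smul, hact]
    at h1
  have h2 : f * w = shiftScale (-β) γ f := by
    have := congrArg (fun p => p.coeff (ofAdd (1 : ℤ))) h1
    simpa using this
  obtain ⟨q, a, rfl, hq⟩ :=
    exists_eq_map_C_of_shiftScale_eq_mul (neg_ne_zero.2 hβ) hγ hf h2.symm
  refine ⟨q, a, h.injective ?_, hq⟩
  rw [hzf, ← evalPair_map_C (isPair_d_u.commute_scaleElt_shiftElt), h.map_ι]

end NormalElements

section WeightParameters

open Polynomial

variable {K : Type} [Field K] {β γ r β' γ' r' : K}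

theorem scaleElt_zero_eq {B : Type*} [Ring B] [Algebra K B] {D U : B} (hr : r * (1 + β) = 1) :
    scaleElt β γ 0 r D U = r • (U * D - D * U + (r * γ) • 1) := by
  rw [scaleElt, shiftElt]
  match_scalars <;> first | ring1 | linear_combination -hr

theorem character_scaleElt (hr : r * (1 + β) = 1) {B : Type*} [Ring B] [Algebra K B] {D U : B}
    (χ : B →ₐ[K] K) : χ (scaleElt β γ 0 r D U) = r * (r * γ) := by
  rw [scaleElt_zero_eq hr, map_smul, map_add, map_sub, map_mul, map_mul, map_smul, map_one,
    mul_comm (χ U), sub_self, zero_add, smul_eq_mul, smul_eq_mul, mul_one]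

theorem exists_scaleElt_mul_eq (hβ : β ≠ 0) (hr : r * (1 + β) = 1) (a : DownUp K (1 - β) β γ) :
    ∃ b, a * scaleElt β γ 0 r (d K (1 - β) β γ) (u K (1 - β) β γ) =
      scaleElt β γ 0 r (d K (1 - β) β γ) (u K (1 - β) β γ) * b := by
  have h := isPair_d_u (K := K) (α := 1 - β) (β := β) (γ := γ)
  induction a using induction_of_adjoin adjoin_eq_top with
  | hD => exact ⟨-β • d K _ _ _, by
      rw [h.mul_scaleElt (by simp) (by simpa using hr), mul_smul_comm]⟩
  | hU => exact ⟨(-β)⁻¹ • u K _ _ _, by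
      rw [mul_smul_comm, h.scaleElt_mul (by simp) (by simpa using hr),
        inv_smul_smul₀ (neg_ne_zero.2 hβ)]⟩
  | hK k => exact ⟨algebraMap K _ k, Algebra.commutes _ _⟩
  | hadd x y hx hy =>
    obtain ⟨x', hx⟩ := hx
    obtain ⟨y', hy⟩ := hy
    exact ⟨x' + y', by rw [add_mul, hx, hy, mul_add]⟩
  | hmul x y hx hy =>
    obtain ⟨x', hx⟩ := hx
    obtain ⟨y', hy⟩ := hy
    exact ⟨x' * y', by rw [mul_assoc, hy, ← mul_assoc, hx, mul_assoc]⟩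

theorem add_one_smul_eq_zero {B : Type*} [Ring B] [Algebra K B] {x : B} (h : x = -β • x) :
    (1 + β) • x = 0 := by
  rw [add_smul, one_smul]
  exact eq_neg_iff_add_eq_zero.1 (h.trans (neg_smul _ _))

theorem isPair_matrix {c : K} (hc : c * (1 - β) = -γ) :
    IsPair (1 - β) β γ !![0, c; 0, 0] !![(0 : K), 0; 1, 0] := by
  constructor
  · ext i j
    fin_cases i <;> fin_cases j <;> simp [Matrix.mul_apply, Fin.sum_univ_two]
    linear_combination -c * hc
  · ext i j
    fin_cases i <;> fin_cases j <;> simp [Matrix.mul_apply, Fin.sum_univ_two]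
    linear_combination -hc

variable [CharZero K]

theorem exists_symm_scaleElt_eq_aeval {s : K} (hβ : β ≠ 0) (hγ : γ ≠ 0) (hβ' : β' ≠ 0)
    (hγ' : γ' ≠ 0) (hs : s * (1 + β) = 0) (hr : r * (1 + β) + 2 * s * γ = 1)
    (hr' : r' * (1 + β') = 1) (φ : DownUp K (1 - β) β γ ≃ₐ[K] DownUp K (1 - β') β' γ') :
    ∃ (q : K[X]) (a : K),
      φ.symm (scaleElt β' γ' 0 r' (d K _ _ _) (u K _ _ _)) =
        aeval (scaleElt β γ s r (d K (1 - β) β γ) (u K (1 - β) β γ)) q ∧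
      q.comp (C (-β) * X) = a • q := by
  refine exists_eq_aeval_of_normal hβ hγ hs hr ?_ fun a => ?_
  · have hr0 : r' ≠ 0 := left_ne_zero_of_mul_eq_one hr'
    have h := character_scaleElt hr' (γ := γ') (D := d K (1 - β') β' γ') (U := u K (1 - β') β' γ')
      ((counit (1 - β) β γ).comp φ.symm.toAlgHom)
    rw [AlgHom.comp_apply] at h
    exact h.trans_ne (mul_ne_zero hr0 (mul_ne_zero hr0 hγ'))
  · obtain ⟨b, hb⟩ := exists_scaleElt_mul_eq hβ' hr' (γ := γ') (φ a)
    refine ⟨φ.symm b, φ.injective ?_⟩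
    simpa using hb

/-- The case `β = -1` cannot be isomorphic to the case `β' ≠ -1`. -/
theorem eq_neg_one_of_algEquiv (hγ : γ ≠ 0) (hβ' : β' ≠ 0) (hγ' : γ' ≠ 0)
    (φ : DownUp K (1 - (-1)) (-1) γ ≃ₐ[K] DownUp K (1 - β') β' γ') : β' = -1 := by
  by_contra hne
  have hne' : 1 + β' ≠ 0 := fun h => hne (by linear_combination h)
  have hr' : (1 + β')⁻¹ * (1 + β') = 1 := inv_mul_cancel₀ hne'
  have hs : (2 * γ)⁻¹ * (1 + -1 : K) = 0 := by ring
  have hr : (0 : K) * (1 + -1) + 2 * (2 * γ)⁻¹ * γ = 1 := by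
    field_simp
    ring
  obtain ⟨q, -, hq, -⟩ :=
    exists_symm_scaleElt_eq_aeval (neg_ne_zero.2 one_ne_zero) hγ hβ' hγ' hs hr hr' φ
  set P := scaleElt (-1) γ (2 * γ)⁻¹ 0 (d K (1 - (-1)) (-1) γ) (u K (1 - (-1)) (-1) γ)
  set P' := scaleElt β' γ' 0 (1 + β')⁻¹ (d K (1 - β') β' γ') (u K (1 - β') β' γ') with hP'
  have hcomm : ∀ a, Commute a P := by
    intro a
    induction a using induction_of_adjoin adjoin_eq_top with
    | hD =>
      have := isPair_d_u.mul_scaleElt (K := K) hs hr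
      rwa [neg_neg, one_smul] at this
    | hU =>
      have := isPair_d_u.scaleElt_mul (K := K) hs hr
      rw [neg_neg, one_smul] at this
      exact this.symm
    | hK k => exact Algebra.commutes _ _
    | hadd x y hx hy => exact hx.add_left hy
    | hmul x y hx hy => exact hx.mul_left hy
  have hcomm' : ∀ a, Commute a (φ.symm P') := by
    intro a
    rw [hq]
    clear hq
    induction q using Polynomial.induction_on' with
    | add p q hp hq => rw [map_add]; exact hp.add_right hq
    | monomial n c =>
      rw [aeval_monomial]
      exact (Algebra.commute_algebraMap_right c a).mul_right ((hcomm a).pow_right n)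
  have h1 : Commute (d K (1 - β') β' γ') P' := by
    have := (hcomm' (φ.symm (d K (1 - β') β' γ'))).map φ
    simpa using this
  have h2 := isPair_d_u.mul_scaleElt (K := K) (γ := γ') (r := (1 + β')⁻¹) (s := 0) (β := β')
    (by simp) (by simpa using hr')
  rw [← hP', h1.eq] at h2
  have h3 : (1 + β') • (P' * d K (1 - β') β' γ') = 0 := by
    exact add_one_smul_eq_zero h2
  have h4 := eq_zero_of_aeval_scaleElt_mul_eq_zero (K := K) (γ := γ') (r := (1 + β')⁻¹) (s := 0)
    (q := X) hβ' (by simp) (by simpa using hr') (by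
      rw [aeval_X]; exact (smul_eq_zero.1 h3).resolve_left hne')
  exact X_ne_zero h4

theorem exists_map_scaleElt_eq_smul (hβ : β ≠ 0) (hγ : γ ≠ 0) (hβ' : β' ≠ 0) (hγ' : γ' ≠ 0)
    (hr : r * (1 + β) = 1) (hr' : r' * (1 + β') = 1)
    (φ : DownUp K (1 - β) β γ ≃ₐ[K] DownUp K (1 - β') β' γ') :
    ∃ a : K, a ≠ 0 ∧ scaleElt β' γ' 0 r' (d K (1 - β') β' γ') (u K (1 - β') β' γ') =
      a • φ (scaleElt β γ 0 r (d K (1 - β) β γ) (u K (1 - β) β γ)) := by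
  obtain ⟨q, a, hq, hqa⟩ := exists_symm_scaleElt_eq_aeval (s := 0) hβ hγ hβ' hγ' (by simp)
    (by simpa using hr) hr' φ
  obtain ⟨q', -, hq', -⟩ := exists_symm_scaleElt_eq_aeval (s := 0) hβ' hγ' hβ hγ (by simp)
    (by simpa using hr') hr φ.symm
  set P := scaleElt β γ 0 r (d K (1 - β) β γ) (u K (1 - β) β γ)
  set P' := scaleElt β' γ' 0 r' (d K (1 - β') β' γ') (u K (1 - β') β' γ')
  rw [AlgEquiv.symm_symm] at hq'
  rw [AlgEquiv.symm_apply_eq, ← aeval_algHom_apply φ, hq', ← aeval_comp] at hq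
  have hX : X - q.comp q' = 0 := by
    refine eq_zero_of_aeval_scaleElt_mul_eq_zero (K := K) (γ := γ') (r := r') (s := 0) hβ' (by simp)
      (by simpa using hr') ?_
    rw [map_sub, aeval_X, sub_eq_zero.2 hq, zero_mul]
  have hdeg : q.natDegree = 1 := by
    have := congrArg natDegree (sub_eq_zero.1 hX)
    rw [natDegree_X, natDegree_comp] at this
    exact Nat.eq_one_of_mul_eq_one_right this.symm
  obtain ⟨s, hs0, t, rfl⟩ := natDegree_eq_one.1 hdeg
  have h1 := congrArg (coeff · 1) hqa
  have h0 := congrArg (coeff · 0) hqa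
  simp only [add_comp, mul_comp, C_comp, X_comp, coeff_add, coeff_C_mul, mul_coeff_zero, coeff_C_zero,
    coeff_X_zero, mul_zero, zero_add, coeff_smul, smul_eq_mul, coeff_X_one, mul_one,
    coeff_C_succ, add_zero] at h0 h1
  have ha : a = -β := mul_right_cancel₀ hs0 (by linear_combination -h1)
  have hβ1 : 1 + β ≠ 0 := right_ne_zero_of_mul_eq_one hr
  have ht : t = 0 := (mul_eq_zero.1 (by linear_combination h0 + t * ha :
    (1 + β) * t = 0)).resolve_left hβ1
  refine ⟨s, hs0, ?_⟩
  rw [aeval_comp, ← hq', ht] at hq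
  simpa [Algebra.smul_def] using hq

/-- The case where neither algebra has a central scaling element. -/
theorem eq_or_mul_eq_one_of_algEquiv (hβ : β ≠ 0) (hγ : γ ≠ 0) (hβ' : β' ≠ 0) (hγ' : γ' ≠ 0)
    (hr : r * (1 + β) = 1) (hr' : r' * (1 + β') = 1) (hβ1 : 1 - β' ≠ 0)
    (φ : DownUp K (1 - β) β γ ≃ₐ[K] DownUp K (1 - β') β' γ') : β' = β ∨ β * β' = 1 := by
  obtain ⟨a, ha, hP⟩ := exists_map_scaleElt_eq_smul hβ hγ hβ' hγ' hr hr' φ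
  obtain ⟨c, hc⟩ : ∃ c, c * (1 - β') = -γ' := ⟨-γ' * (1 - β')⁻¹, inv_mul_cancel_right₀ hβ1 _⟩
  have hr0 : r' ≠ 0 := left_ne_zero_of_mul_eq_one hr'
  have hβ2 : 1 + β ≠ 0 := right_ne_zero_of_mul_eq_one hr
  have hβ2' : 1 + β' ≠ 0 := right_ne_zero_of_mul_eq_one hr'
  obtain ⟨w, hw⟩ : ∃ w, w = r' * (r' * γ' - c) := ⟨_, rfl⟩
  have hw' : r' * (r' * γ' + c) = -β' * w := by
    rw [hw]
    linear_combination r' * γ' * hr' + r' * hc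
  have hw0 : w ≠ 0 := by
    intro h0
    rw [hw] at h0
    have : 2 * (r' * (r' * γ')) = 0 := by
      linear_combination (1 - β') * h0 + r' * γ' * hr' + r' * hc
    simp_all
  let ρ := lift (isPair_matrix hc)
  have hρ : ρ (scaleElt β' γ' 0 r' (d K (1 - β') β' γ') (u K (1 - β') β' γ')) =
      !![w, 0; 0, -β' * w] := by
    rw [scaleElt_zero_eq hr', ← hw', hw]
    simp only [map_smul, map_add, map_sub, map_mul, map_one, ρ, lift_d, lift_u]
    ext i j
    fin_cases i <;> fin_cases j <;> simp <;> ring_nf <;> simp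
  obtain ⟨D, hD⟩ : ∃ D, D = ρ (φ (d K (1 - β) β γ)) := ⟨_, rfl⟩
  have hDW : D * !![w, 0; 0, -β' * w] = -β • (!![w, 0; 0, -β' * w] * D) := by
    rw [hD, ← hρ, hP]
    have := isPair_d_u.mul_scaleElt (K := K) (γ := γ) (r := r) (s := 0) (β := β)
      (by simp) (by simpa using hr)
    have := congrArg (fun x => a • ρ (φ x)) this
    simp only [map_mul, map_smul] at this ⊢
    rw [mul_smul_comm, this, smul_mul_assoc, smul_comm]
  have hentry : ∀ i j, (D * !![w, 0; 0, -β' * w]) i j = (-β • (!![w, 0; 0, -β' * w] * D)) i j := by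
    rw [hDW]
    exact fun _ _ => rfl
  rw [Matrix.eta_fin_two D, Matrix.mul_fin_two, Matrix.mul_fin_two] at hentry
  have h00 := hentry 0 0
  have h01 := hentry 0 1
  have h10 := hentry 1 0
  have h11 := hentry 1 1
  simp at h00 h01 h10 h11
  have h00' : D 0 0 = 0 := by
    have : (w * (1 + β)) * D 0 0 = 0 := by linear_combination h00
    simp_all
  have h11' : D 1 1 = 0 := by
    have : (β' * w * (1 + β)) * D 1 1 = 0 := by linear_combination -h11
    simp_all
  by_contra! hne
  have h01' : D 0 1 = 0 := by
    have : (w * (β' - β)) * D 0 1 = 0 := by linear_combination h01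
    simp_all [sub_eq_zero]
  have h10' : D 1 0 = 0 := by
    have : (w * (β * β' - 1)) * D 1 0 = 0 := by linear_combination -h10
    simp_all [sub_eq_zero]
  have hD0 : D = 0 := by
    rw [Matrix.eta_fin_two D, h00', h01', h10', h11']
    ext i j
    fin_cases i <;> fin_cases j <;> rfl
  rw [hP, scaleElt_zero_eq hr] at hρ
  simp only [map_smul, map_add, map_sub, map_mul, map_one, ← hD, hD0] at hρ
  have e0 := congrFun (congrFun hρ 0) 0
  have e1 := congrFun (congrFun hρ 1) 1
  simp at e0 e1
  have : w * (1 + β') = 0 := by linear_combination e1 - e0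
  simp_all

theorem parameters_of_unipotent {α α' : K} (hβ : β ≠ 0) (hβ' : β' ≠ 0) (hγ : γ ≠ 0) (hγ' : γ' ≠ 0)
    (hαβ : α + β = 1) (hαβ' : α' + β' = 1) (φ : DownUp K α β γ ≃ₐ[K] DownUp K α' β' γ') :
    (α' = α ∧ β' = β) ∨ (α' = -α * β⁻¹ ∧ β' = β⁻¹) := by
  obtain rfl : α = 1 - β := eq_sub_of_add_eq hαβ
  obtain rfl : α' = 1 - β' := eq_sub_of_add_eq hαβ'
  suffices h : β' = β ∨ β * β' = 1 by
    rcases h with rfl | h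
    · exact Or.inl ⟨rfl, rfl⟩
    · obtain rfl := eq_inv_of_mul_eq_one_right h
      refine Or.inr ⟨?_, rfl⟩
      field_simp
      ring
  by_cases h1 : β = -1
  · subst h1
    exact Or.inl (eq_neg_one_of_algEquiv hγ hβ' hγ' φ)
  by_cases h1' : β' = -1
  · subst h1'
    exact absurd (eq_neg_one_of_algEquiv hγ' hβ hγ φ.symm) h1
  have hr : (1 + β)⁻¹ * (1 + β) = 1 := inv_mul_cancel₀ fun h => h1 (by linear_combination h)
  have hr' : (1 + β')⁻¹ * (1 + β') = 1 := inv_mul_cancel₀ fun h => h1' (by linear_combination h)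
  by_cases h2' : 1 - β' = 0
  · by_cases h2 : 1 - β = 0
    · exact Or.inl (by linear_combination h2 - h2')
    · rw [mul_comm β]
      exact (eq_or_mul_eq_one_of_algEquiv hβ' hγ' hβ hγ hr' hr h2 φ.symm).imp_left Eq.symm
  · exact eq_or_mul_eq_one_of_algEquiv hβ hγ hβ' hγ' hr hr' h2' φ

end WeightParameters

end DownUp

/-- the isomorphism problem for Noetherian down-up algebras of
the same type (with `char K = 0` assumed in type (d)):
`A(α,β,γ) ≅ A(α',β',γ')` iff `(γ = 0 ↔ γ' = 0)` and either `(α',β') = (α,β)`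
or `(α',β') = (−αβ⁻¹, β⁻¹)`. -/
theorem downUp_isomorphism_problem (K : Type) [Field K] [IsAlgClosed K]
    (α β γ α' β' γ' : K) (hβ : β ≠ 0) (hβ' : β' ≠ 0)
    (htype1 : γ = 0 ↔ γ' = 0) (htype2 : α + β = 1 ↔ α' + β' = 1)
    (hchar : γ ≠ 0 → α + β = 1 → CharZero K) :
    Nonempty (DownUp K α β γ ≃ₐ[K] DownUp K α' β' γ') ↔
      ((γ = 0 ↔ γ' = 0) ∧
        ((α' = α ∧ β' = β) ∨ (α' = -α * β⁻¹ ∧ β' = β⁻¹))) := by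
  constructor
  · rintro ⟨φ⟩
    refine ⟨htype1, ?_⟩
    by_cases hγ : γ = 0
    · obtain rfl := htype1.1 hγ
      subst hγ
      exact DownUp.parameters_of_graded hβ hβ' φ
    · have hγ' : γ' ≠ 0 := fun h => hγ (htype1.2 h)
      by_cases hαβ : α + β = 1
      · have := hchar hγ hαβ
        exact DownUp.parameters_of_unipotent hβ hβ' hγ hγ' hαβ (htype2.1 hαβ) φ
      · exact DownUp.parameters_of_hyperbolic hβ hβ' hγ hγ' hαβ (fun h => hαβ (htype2.2 h)) φ
  · rintro ⟨-, ⟨rfl, rfl⟩ | ⟨rfl, rfl⟩⟩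
    · exact DownUp.nonempty_algEquiv_of_zero_iff htype1
    · obtain ⟨e⟩ := DownUp.nonempty_algEquiv_swap (K := K) (α := α) (γ := γ) hβ
      obtain ⟨f⟩ := DownUp.nonempty_algEquiv_of_zero_iff (K := K) (α := -α * β⁻¹) (β := β⁻¹)
        (γ := -γ * β⁻¹) (γ' := γ') (by simpa [hβ] using htype1)
      exact ⟨e.trans f⟩
end
end

section
/- Let K be an algebraically closed field of characteristic 0, let η ∈ K with η ≠ 0, let γ ∈ K with γ ≠ 0, and let A = A(1+η, −η, γ) (so α = 1+η, β = −η). Let M be a finite-dimensional left A-module and L ⊆ M a submodule such that L and M/L are both simple, L is a highest weight module of weight λ, M/L is a highest weight module of weight μ, λ ≠ μ, and L has no complementary submodule in M (the extension is nonsplit). Then either (i) M is itself a highest weight module of weight μ, or (ii) there exists a nonzero w ∈ L with (d·u)·w = 0 and (u·d)·w = (μ − γ)·β^{-1}·w. -/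
noncomputable section

namespace DownUp

section Relations

variable (K : Type) [Field K] (α β γ : K)

theorem d_mul_d_mul_u :
    d K α β γ * d K α β γ * u K α β γ =
      α • (d K α β γ * u K α β γ * d K α β γ) +
        β • (u K α β γ * d K α β γ * d K α β γ) + γ • d K α β γ := by
  simpa only [d, u, map_mul, map_add, map_smul] using
    RingQuot.mkAlgHom_rel K (DownUpRel.rel1 (K := K) (α := α) (β := β) (γ := γ))

theorem d_mul_u_mul_u :
    d K α β γ * u K α β γ * u K α β γ =
      α • (u K α β γ * d K α β γ * u K α β γ) +
        β • (u K α β γ * u K α β γ * d K α β γ) + γ • u K α β γ := by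
  simpa only [d, u, map_mul, map_add, map_smul] using
    RingQuot.mkAlgHom_rel K (DownUpRel.rel2 (K := K) (α := α) (β := β) (γ := γ))

/-- The elements `du` and `ud` of a down-up algebra commute. -/
theorem commute_d_mul_u_u_mul_d :
    Commute (d K α β γ * u K α β γ) (u K α β γ * d K α β γ) := by
  have h₁ : d K α β γ * u K α β γ * (u K α β γ * d K α β γ) =
      d K α β γ * u K α β γ * u K α β γ * d K α β γ := by simp only [mul_assoc]
  have h₂ : u K α β γ * d K α β γ * (d K α β γ * u K α β γ) =
      u K α β γ * (d K α β γ * d K α β γ * u K α β γ) := by simp only [mul_assoc]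
  rw [commute_iff_eq, h₁, h₂, d_mul_d_mul_u, d_mul_u_mul_u]
  simp only [add_mul, mul_add, smul_mul_assoc, mul_smul_comm, mul_assoc]

end Relations

section Modules

variable {K : Type} [Field K] {α β γ : K}
  {N : Type} [AddCommGroup N] [Module K N] [Module (DownUp K α β γ) N]
  [IsScalarTower K (DownUp K α β γ) N]

/-- A subspace stable under `d` and `u` is stable under the whole down-up algebra. -/
theorem smul_mem_of_stable (S : Submodule K N) (hd : ∀ x ∈ S, d K α β γ • x ∈ S)
    (hu : ∀ x ∈ S, u K α β γ • x ∈ S) (a : DownUp K α β γ) {x : N} (hx : x ∈ S) :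
    a • x ∈ S := by
  obtain ⟨p, rfl⟩ := RingQuot.mkAlgHom_surjective K (DownUpRel K α β γ) a
  induction p using FreeAlgebra.induction generalizing x with
  | grade0 r =>
    rw [AlgHom.commutes, algebraMap_smul]
    exact S.smul_mem r hx
  | grade1 i =>
    fin_cases i
    · exact hd x hx
    · exact hu x hx
  | mul p q hp hq =>
    rw [map_mul, mul_smul]
    exact hp (hq hx)
  | add p q hp hq =>
    rw [map_add, add_smul]
    exact S.add_mem (hp hx) (hq hx)

variable (α β γ) in
/-- The eigenvalues of `du` and `ud` on `u ^ k • v`, for `v` a highest weight vector of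
weight `lam`. -/
def weight (lam : K) : ℕ → K × K
  | 0 => (lam, 0)
  | k + 1 => (α * (weight lam k).1 + β * (weight lam k).2 + γ, (weight lam k).1)

variable {lam : K} {v : N}

theorem smul_u_pow_smul (hd : d K α β γ • v = 0)
    (hdu : (d K α β γ * u K α β γ) • v = lam • v) (k : ℕ) :
    (d K α β γ * u K α β γ) • u K α β γ ^ k • v =
        (weight α β γ lam k).1 • u K α β γ ^ k • v ∧
      (u K α β γ * d K α β γ) • u K α β γ ^ k • v =
        (weight α β γ lam k).2 • u K α β γ ^ k • v := by
  induction k with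
  | zero => simp [weight, hdu, mul_smul (u K α β γ), hd]
  | succ k ih =>
    obtain ⟨h₁, h₂⟩ := ih
    rw [pow_succ', mul_smul (u K α β γ) (u K α β γ ^ k)]
    generalize u K α β γ ^ k • v = y at h₁ h₂ ⊢
    constructor
    · have h₃ : u K α β γ * d K α β γ * u K α β γ =
          u K α β γ * (d K α β γ * u K α β γ) := mul_assoc _ _ _
      have h₄ : u K α β γ * u K α β γ * d K α β γ =
          u K α β γ * (u K α β γ * d K α β γ) := mul_assoc _ _ _
      rw [← mul_smul, d_mul_u_mul_u, h₃, h₄, add_smul, add_smul, smul_assoc α, smul_assoc β,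
        smul_assoc γ, mul_smul (u K α β γ) (d K α β γ * u K α β γ),
        mul_smul (u K α β γ) (u K α β γ * d K α β γ), h₁, h₂,
        smul_comm (u K α β γ) (weight α β γ lam k).1,
        smul_comm (u K α β γ) (weight α β γ lam k).2]
      simp only [weight, add_smul, mul_smul]
    · rw [mul_smul (u K α β γ) (d K α β γ), ← mul_smul (d K α β γ), h₁,
        smul_comm (u K α β γ)]
      rfl

theorem d_smul_u_pow_succ_smul (hd : d K α β γ • v = 0)
    (hdu : (d K α β γ * u K α β γ) • v = lam • v) (k : ℕ) :
    d K α β γ • u K α β γ ^ (k + 1) • v =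
      (weight α β γ lam k).1 • u K α β γ ^ k • v := by
  rw [pow_succ', mul_smul, ← mul_smul (d K α β γ), (smul_u_pow_smul hd hdu k).1]

/-- A highest weight module is spanned by the vectors `u ^ k • v`. -/
theorem span_u_pow_smul_eq_top (hd : d K α β γ • v = 0)
    (hdu : (d K α β γ * u K α β γ) • v = lam • v)
    (hv : ∀ x : N, ∃ a : DownUp K α β γ, x = a • v) :
    Submodule.span K (Set.range fun k : ℕ => u K α β γ ^ k • v) = ⊤ := by
  set S := Submodule.span K (Set.range fun k : ℕ => u K α β γ ^ k • v) with hS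
  have hmem (k : ℕ) : u K α β γ ^ k • v ∈ S := Submodule.subset_span ⟨k, rfl⟩
  have hstable (a : DownUp K α β γ) (h : ∀ k : ℕ, a • u K α β γ ^ k • v ∈ S) :
      ∀ x ∈ S, a • x ∈ S := by
    have : S ≤ S.comap (Algebra.lsmul K K N a) :=
      Submodule.span_le.mpr (by rintro _ ⟨k, rfl⟩; exact h k)
    exact fun x hx => this hx
  refine eq_top_iff.mpr fun x _ => ?_
  obtain ⟨a, rfl⟩ := hv x
  refine smul_mem_of_stable S (hstable _ fun k => ?_) (hstable _ fun k => ?_) a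
    (by simpa using hmem 0)
  · cases k with
    | zero => simp [hd]
    | succ k =>
      rw [d_smul_u_pow_succ_smul hd hdu]
      exact S.smul_mem _ (hmem k)
  · rw [← mul_smul, ← pow_succ']
    exact hmem (k + 1)

/-- An element of the algebra acting on each `u ^ k • v` by a scalar which is nonzero
whenever the vector is acts bijectively on a finite-dimensional highest weight module. -/
theorem bijective_smul_of_eigenvalue_ne_zero [FiniteDimensional K N] (hd : d K α β γ • v = 0)
    (hdu : (d K α β γ * u K α β γ) • v = lam • v)
    (hv : ∀ x : N, ∃ a : DownUp K α β γ, x = a • v) (z : DownUp K α β γ) (c : ℕ → K)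
    (hz : ∀ k, z • u K α β γ ^ k • v = c k • u K α β γ ^ k • v)
    (hc : ∀ k, u K α β γ ^ k • v ≠ 0 → c k ≠ 0) :
    Function.Bijective fun x : N => z • x := by
  have hsurj : Function.Surjective (Algebra.lsmul K K N z) := by
    rw [← LinearMap.range_eq_top, eq_top_iff, ← span_u_pow_smul_eq_top hd hdu hv,
      Submodule.span_le]
    rintro _ ⟨k, rfl⟩
    by_cases h : u K α β γ ^ k • v = 0
    · simp [h]
    · refine ⟨(c k)⁻¹ • u K α β γ ^ k • v, ?_⟩
      simp only [map_smul, Algebra.lsmul_coe]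
      rw [hz, inv_smul_smul₀ (hc k h)]
  exact ⟨LinearMap.injective_iff_surjective.mpr hsurj, hsurj⟩

end Modules

section Eta

variable {K : Type} [Field K] {η γ : K}

/-- The combination `du - η ud` grades highest weight modules of `A(1 + η, -η, γ)`. -/
theorem weight_fst_sub_mul_snd (lam : K) (k : ℕ) :
    (weight (1 + η) (-η) γ lam k).1 - η * (weight (1 + η) (-η) γ lam k).2 =
      lam + k * γ := by
  induction k with
  | zero => simp [weight]
  | succ k ih =>
    simp only [weight]
    push_cast
    linear_combination ih

variable [CharZero K] {N : Type} [AddCommGroup N] [Module K N]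
  [Module (DownUp K (1 + η) (-η) γ) N] [IsScalarTower K (DownUp K (1 + η) (-η) γ) N]
  [FiniteDimensional K N] {lam : K} {v : N}

theorem finite_setOf_u_pow_smul_ne_zero (hγ : γ ≠ 0) (hd : d K (1 + η) (-η) γ • v = 0)
    (hdu : (d K (1 + η) (-η) γ * u K (1 + η) (-η) γ) • v = lam • v) :
    {k : ℕ | u K (1 + η) (-η) γ ^ k • v ≠ 0}.Finite := by
  let E : Module.End K N := Algebra.lsmul K K N
    (d K (1 + η) (-η) γ * u K (1 + η) (-η) γ -
      η • (u K (1 + η) (-η) γ * d K (1 + η) (-η) γ))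
  have hli := Module.End.eigenvectors_linearIndependent' E
    (fun k : {k : ℕ | u K (1 + η) (-η) γ ^ k • v ≠ 0} => lam + (k : ℕ) * γ)
    (fun i j hij => by
      ext
      simpa [hγ] using hij)
    (fun k => u K (1 + η) (-η) γ ^ (k : ℕ) • v)
    (fun k => by
      refine ⟨Module.End.mem_eigenspace_iff.mpr ?_, k.2⟩
      obtain ⟨h₁, h₂⟩ := smul_u_pow_smul hd hdu (k : ℕ)
      simp only [E, Algebra.lsmul_coe]
      rw [sub_smul, smul_assoc, h₁, h₂, ← weight_fst_sub_mul_snd (η := η), sub_smul,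
        mul_smul])
  exact Set.finite_coe_iff.mp hli.finite

/-- In a simple highest weight module of weight `lam`, the pair `(mu, 0)` with `mu ≠ lam`
is not a weight. -/
theorem weight_ne_of_isSimpleModule [IsSimpleModule (DownUp K (1 + η) (-η) γ) N]
    (hγ : γ ≠ 0) (hd : d K (1 + η) (-η) γ • v = 0)
    (hdu : (d K (1 + η) (-η) γ * u K (1 + η) (-η) γ) • v = lam • v) (hv : v ≠ 0)
    {mu : K} (hlm : lam ≠ mu) {k : ℕ} (hk : u K (1 + η) (-η) γ ^ k • v ≠ 0) :
    weight (1 + η) (-η) γ lam k ≠ (mu, 0) := by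
  intro hw
  cases k with
  | zero => exact hlm (congrArg Prod.fst hw)
  | succ k =>
    have hde : d K (1 + η) (-η) γ • u K (1 + η) (-η) γ ^ (k + 1) • v = 0 := by
      rw [d_smul_u_pow_succ_smul hd hdu, show (weight (1 + η) (-η) γ lam k).1 = 0
        from congrArg Prod.snd hw, zero_smul]
    have hdue := (smul_u_pow_smul hd hdu (k + 1)).1
    rw [hw] at hdue
    have hmu : mu = lam + (k + 1 : ℕ) * γ := by
      rw [← weight_fst_sub_mul_snd (η := η), hw]
      simp
    have hinj := (bijective_smul_of_eigenvalue_ne_zero hde hdue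
      (fun x => by
        obtain ⟨a, ha⟩ := IsSimpleModule.toSpanSingleton_surjective
          (DownUp K (1 + η) (-η) γ) hk x
        exact ⟨a, ha.symm⟩)
      (d K (1 + η) (-η) γ * u K (1 + η) (-η) γ -
        η • (u K (1 + η) (-η) γ * d K (1 + η) (-η) γ) - algebraMap K _ lam)
      (fun j => (k + 1 + j : ℕ) * γ)
      (fun j => by
        obtain ⟨h₁, h₂⟩ := smul_u_pow_smul hde hdue j
        rw [sub_smul, sub_smul, smul_assoc, h₁, h₂, algebraMap_smul,
          smul_smul η, ← sub_smul, weight_fst_sub_mul_snd, ← sub_smul, hmu]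
        push_cast
        congr 1
        ring)
      (fun j _ => mul_ne_zero (Nat.cast_ne_zero.mpr (by omega)) hγ)).1
    refine hv (hinj ?_)
    simp only [smul_zero]
    rw [sub_smul, sub_smul, smul_assoc, hdu, mul_smul (u K (1 + η) (-η) γ), hd,
      algebraMap_smul]
    simp

/-- If `mu ≠ lam`, some element `(du - mu) + t ud` acts bijectively on a
finite-dimensional simple highest weight module of weight `lam`. -/
theorem exists_bijective_smul [IsSimpleModule (DownUp K (1 + η) (-η) γ) N]
    (hγ : γ ≠ 0) (hd : d K (1 + η) (-η) γ • v = 0)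
    (hdu : (d K (1 + η) (-η) γ * u K (1 + η) (-η) γ) • v = lam • v)
    (hv : ∀ x : N, ∃ a : DownUp K (1 + η) (-η) γ, x = a • v) {mu : K} (hlm : lam ≠ mu) :
    ∃ t : K, Function.Bijective fun x : N =>
      (d K (1 + η) (-η) γ * u K (1 + η) (-η) γ - algebraMap K _ mu +
        t • (u K (1 + η) (-η) γ * d K (1 + η) (-η) γ)) • x := by
  have hv0 : v ≠ 0 := by
    rintro rfl
    have := IsSimpleModule.nontrivial (DownUp K (1 + η) (-η) γ) N
    obtain ⟨x, hx⟩ := exists_ne (0 : N)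
    obtain ⟨a, rfl⟩ := hv x
    exact hx (smul_zero a)
  let wt := weight (1 + η) (-η) γ lam
  obtain ⟨t, ht⟩ := ((finite_setOf_u_pow_smul_ne_zero hγ hd hdu).image
    fun k => (mu - (wt k).1) / (wt k).2).exists_notMem
  refine ⟨t, bijective_smul_of_eigenvalue_ne_zero hd hdu hv _
    (fun k => (wt k).1 - mu + t * (wt k).2) (fun k => ?_) (fun k hk h => ?_)⟩
  · obtain ⟨h₁, h₂⟩ := smul_u_pow_smul hd hdu k
    rw [add_smul, sub_smul, smul_assoc, h₁, h₂, algebraMap_smul, add_smul, sub_smul,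
      mul_smul]
  · by_cases h₂ : (wt k).2 = 0
    · refine weight_ne_of_isSimpleModule hγ hd hdu hv0 hlm hk (Prod.ext ?_ h₂)
      simpa [h₂, sub_eq_zero] using h
    · refine ht ⟨k, hk, ?_⟩
      rw [div_eq_iff h₂]
      linear_combination -h

end Eta

end DownUp

/-- for `A_η = A(1+η, −η, γ)`, a nonsplit extension `M` of the
simple highest weight module `L(μ) = M/L` by the simple highest weight module
`L(λ) = L` with `λ ≠ μ` either is an image of the Verma module `V(μ)` (i.e. is
itself a highest weight module of weight `μ`), or `L` contains a nonzero
vector `w` annihilated by `H_μ`, i.e. with `(du)·w = 0` and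
`(ud)·w = (μ−γ)·β⁻¹·w` (here `β = −η`). -/
theorem downUp_eta_nonsplit_extension (K : Type) [Field K] [IsAlgClosed K]
    [CharZero K] (η γ : K) (hη0 : η ≠ 0) (hγ : γ ≠ 0) (lam mu : K)
    (hlm : lam ≠ mu)
    (M : Type) [AddCommGroup M] [Module K M] [Module (DownUp K (1 + η) (-η) γ) M]
    [IsScalarTower K (DownUp K (1 + η) (-η) γ) M] [FiniteDimensional K M]
    (L : Submodule (DownUp K (1 + η) (-η) γ) M)
    [IsSimpleModule (DownUp K (1 + η) (-η) γ) L]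
    [IsSimpleModule (DownUp K (1 + η) (-η) γ) (M ⧸ L)]
    -- `L` is a highest weight module of weight `λ`:
    (hL : ∃ v : L, DownUp.d K (1 + η) (-η) γ • v = 0 ∧
        (DownUp.d K (1 + η) (-η) γ * DownUp.u K (1 + η) (-η) γ) • v =
          algebraMap K (DownUp K (1 + η) (-η) γ) lam • v ∧
        ∀ x : L, ∃ a : DownUp K (1 + η) (-η) γ, x = a • v)
    -- `M/L` is a highest weight module of weight `μ`:
    (hQ : ∃ v : M ⧸ L, DownUp.d K (1 + η) (-η) γ • v = 0 ∧
        (DownUp.d K (1 + η) (-η) γ * DownUp.u K (1 + η) (-η) γ) • v =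
          algebraMap K (DownUp K (1 + η) (-η) γ) mu • v ∧
        ∀ x : M ⧸ L, ∃ a : DownUp K (1 + η) (-η) γ, x = a • v)
    -- the extension is nonsplit:
    (hns : ¬ ∃ C : Submodule (DownUp K (1 + η) (-η) γ) M, C ⊓ L = ⊥ ∧ C ⊔ L = ⊤) :
    (∃ v : M, DownUp.d K (1 + η) (-η) γ • v = 0 ∧
        (DownUp.d K (1 + η) (-η) γ * DownUp.u K (1 + η) (-η) γ) • v =
          algebraMap K (DownUp K (1 + η) (-η) γ) mu • v ∧
        ∀ m : M, ∃ a : DownUp K (1 + η) (-η) γ, m = a • v) ∨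
    (∃ w : M, w ∈ L ∧ w ≠ 0 ∧
        (DownUp.d K (1 + η) (-η) γ * DownUp.u K (1 + η) (-η) γ) • w = 0 ∧
        (DownUp.u K (1 + η) (-η) γ * DownUp.d K (1 + η) (-η) γ) • w =
          ((mu - γ) * (-η)⁻¹) • w) := by
  set d := DownUp.d K (1 + η) (-η) γ with hd_def
  set u := DownUp.u K (1 + η) (-η) γ with hu_def
  obtain ⟨x, hdx, hdux, hx⟩ := hL
  obtain ⟨y, hdy, hduy, hy⟩ := hQ
  rw [algebraMap_smul] at hdux hduy
  have : FiniteDimensional K L :=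
    inferInstanceAs (FiniteDimensional K (L.restrictScalars K))
  obtain ⟨t, hinj, hsurj⟩ := DownUp.exists_bijective_smul (N := L) (η := η) hγ hdx hdux hx hlm
  rw [← hd_def, ← hu_def] at hinj hsurj
  set z := d * u - algebraMap K _ mu + t • (u * d) with hz
  have hcomm : Commute (d * u) (u * d) := DownUp.commute_d_mul_u_u_mul_d K _ _ _
  have hzud : Commute z (u * d) :=
    (hcomm.sub_left (Algebra.commute_algebraMap_left _ _)).add_left
      ((Commute.refl _).smul_left t)
  have hker (m : M) (hm : m ∈ L) (h : z • m = 0) : m = 0 := by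
    have : (⟨m, hm⟩ : L) = 0 := hinj (Subtype.ext (by simpa using h))
    simpa using this
  obtain ⟨v₀, rfl⟩ := L.mkQ_surjective y
  rw [← map_smul, ← LinearMap.mem_ker, Submodule.ker_mkQ] at hdy
  have hduv₀ : (d * u) • v₀ - mu • v₀ ∈ L := by
    rw [← algebraMap_smul (DownUp K (1 + η) (-η) γ) mu v₀, ← L.ker_mkQ, LinearMap.mem_ker,
      map_sub, map_smul, map_smul, hduy, algebraMap_smul, sub_self]
  have hzv₀ : z • v₀ ∈ L := by
    rw [hz, add_smul, sub_smul, algebraMap_smul, smul_assoc, mul_smul u d,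
      ← algebraMap_smul (DownUp K (1 + η) (-η) γ) t]
    exact L.add_mem hduv₀ (L.smul_mem _ (L.smul_mem _ hdy))
  obtain ⟨r, hr⟩ := hsurj ⟨z • v₀, hzv₀⟩
  obtain ⟨v, hv⟩ : ∃ v, v = v₀ - r := ⟨_, rfl⟩
  have hzv : z • v = 0 := by
    have : z • (r : M) = z • v₀ := congrArg Subtype.val hr
    rw [hv, smul_sub, this, sub_self]
  have hdv : d • v ∈ L := by
    rw [hv, smul_sub]
    exact L.sub_mem hdy (L.smul_mem _ r.2)
  have hudv : (u * d) • v = 0 := by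
    refine hker _ (by rw [mul_smul]; exact L.smul_mem _ hdv) ?_
    rw [← mul_smul, hzud.eq, mul_smul, hzv, smul_zero]
  have hduv : (d * u) • v = mu • v := by
    rw [hz, add_smul, sub_smul, algebraMap_smul, smul_assoc, hudv, smul_zero, add_zero,
      sub_eq_zero] at hzv
    exact hzv
  by_cases hdv0 : d • v = 0
  · left
    refine ⟨v, hdv0, by rw [hduv, algebraMap_smul], ?_⟩
    let C := Submodule.span (DownUp K (1 + η) (-η) γ) {v}
    have hsup : C ⊔ L = ⊤ := by
      refine eq_top_iff.mpr fun m _ => ?_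
      obtain ⟨a, ha⟩ := hy (L.mkQ m)
      have hmem : m - a • v₀ ∈ L := by
        rw [← L.ker_mkQ, LinearMap.mem_ker, map_sub, ha, map_smul, sub_self]
      have hm : m = a • v + (m - a • v₀ + a • (r : M)) := by
        rw [hv, smul_sub]
        abel
      rw [hm]
      exact Submodule.add_mem_sup
        (C.smul_mem a (Submodule.mem_span_singleton_self v))
        (L.add_mem hmem (L.smul_mem a r.2))
    have hatom : IsAtom L := isSimpleModule_iff_isAtom.mp inferInstance
    have hle : L ≤ C := by
      by_contra h
      exact hns ⟨C, inf_comm L C ▸ (hatom.not_le_iff_disjoint.mp h).eq_bot, hsup⟩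
    intro m
    have hm : m ∈ C := by
      rw [← sup_eq_left.mpr hle, hsup]
      trivial
    obtain ⟨a, ha⟩ := Submodule.mem_span_singleton.mp hm
    exact ⟨a, ha.symm⟩
  · right
    have hdudv : (d * u) • d • v = 0 := by
      rw [mul_smul, ← mul_smul u, hudv, smul_zero]
    refine ⟨d • v, hdv, hdv0, hdudv, ?_⟩
    have hrel := congrArg (· • v) (DownUp.d_mul_d_mul_u K (1 + η) (-η) γ)
    simp only [← hd_def, ← hu_def] at hrel
    rw [add_smul, add_smul, smul_assoc, smul_assoc, smul_assoc, mul_assoc d d u,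
      mul_smul d (d * u), hduv, mul_smul (d * u) d, hdudv, mul_smul (u * d) d,
      smul_comm d mu, smul_zero, zero_add] at hrel
    have h : (-η) • (u * d) • d • v = (mu - γ) • d • v := by
      rw [sub_smul, hrel, add_sub_cancel_right]
    rw [mul_comm (mu - γ), mul_smul _ (mu - γ), ← h, inv_smul_smul₀ (neg_ne_zero.mpr hη0)]
end
end

section
/- Let K be an algebraically closed field of characteristic 0, let η ∈ K with η ≠ 0, let γ ∈ K with γ ≠ 0, and set α = 1+η, β = −η. Let σ be the automorphism of R = K[x,y] with σ(x) = y, σ(y) = α·y + β·x + γ, and for λ ∈ K let J_λ be the ideal of R generated by x and y − λ. If k ∈ ℤ satisfies σ^k(J_λ) = J_λ, then k = 0. -/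
noncomputable section


/-- If an automorphism translates `u` by a fixed constant, its integer powers translate `u` by the
corresponding multiples of that constant. -/
theorem AlgEquiv.zpow_apply_eq_add_zsmul {K A : Type*} [CommRing K] [CommRing A] [Algebra K A]
    (σ : A ≃ₐ[K] A) (u : A) (c : K) (h : σ u = u + algebraMap K A c) (k : ℤ) :
    (σ ^ k) u = u + algebraMap K A (k * c) := by
  have hinv : σ⁻¹ u = u - algebraMap K A c := by
    apply σ.injective
    rw [← AlgEquiv.mul_apply, mul_inv_cancel, AlgEquiv.one_apply, map_sub, h, AlgEquiv.commutes,
      add_sub_cancel_right]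
  induction k with
  | zero => simp
  | succ n ih =>
    rw [zpow_add_one, AlgEquiv.mul_apply, h, map_add, AlgEquiv.commutes, ih]
    push_cast
    ring
  | pred n ih =>
    rw [zpow_sub_one, AlgEquiv.mul_apply, hinv, map_sub, AlgEquiv.commutes, ih]
    push_cast
    ring

open MvPolynomial in
/-- for `A_η` parameters (`α = 1+η`, `β = −η`, `γ ≠ 0`,
`char K = 0`), if `σ^k(J_λ) = J_λ` for some `k ∈ ℤ`, then `k = 0`.  Here `σ`
is the automorphism of `K[x,y]` with `σ(x) = y`, `σ(y) = α·y + β·x + γ`, and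
`J_λ = (x, y − λ)`. -/
theorem downUp_eta_sigma_orbit_Jlambda (K : Type) [Field K] [IsAlgClosed K]
    [CharZero K] (η γ : K) (hη0 : η ≠ 0) (hγ : γ ≠ 0)
    (σ : MvPolynomial (Fin 2) K ≃ₐ[K] MvPolynomial (Fin 2) K)
    (hx : σ (X 0) = X 1)
    (hy : σ (X 1) = C (1 + η) * X 1 + C (-η) * X 0 + C γ)
    (lam : K) (k : ℤ)
    (h : Ideal.map (σ ^ k : MvPolynomial (Fin 2) K ≃ₐ[K] MvPolynomial (Fin 2) K)
        (Ideal.span {X 0, X 1 - C lam}) = Ideal.span {X 0, X 1 - C lam}) :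
    k = 0 := by
  have hu : σ (X 1 - C η * X 0) = X 1 - C η * X 0 + algebraMap K _ γ := by
    have hC : σ (C η) = C η := σ.commutes η
    rw [map_sub, map_mul, hC, hx, hy, algebraMap_eq, C_add, C_neg, C_1]
    ring
  have hk := AlgEquiv.zpow_apply_eq_add_zsmul σ _ γ hu k
  have hmem : (X 1 - C η * X 0 - C lam : MvPolynomial (Fin 2) K) ∈
      Ideal.span {X 0, X 1 - C lam} :=
    Ideal.mem_span_pair.mpr ⟨-C η, 1, by ring⟩
  have himage := Ideal.mem_map_of_mem
    (σ ^ k : MvPolynomial (Fin 2) K ≃ₐ[K] MvPolynomial (Fin 2) K) hmem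
  have hC : (σ ^ k) (C lam) = C lam := (σ ^ k).commutes lam
  rw [h, map_sub, hk, hC, Ideal.mem_span_pair] at himage
  obtain ⟨a, b, hab⟩ := himage
  have hzero := congrArg (eval ![0, lam]) hab
  simpa [algebraMap_eq, hγ] using hzero
end
end

section
/- Let K be an algebraically closed field of characteristic 0, let η ∈ K with η ≠ 0 and η ≠ 1, let γ ∈ K with γ ≠ 0, and set α = 1+η, β = −η. Let σ be the automorphism of R = K[x,y] with σ(x) = y, σ(y) = α·y + β·x + γ. Let λ ∈ K, let (λ_n) be the associated sequence, and let n ≥ 1 be such that λ_{n−1} = 0 and λ_i ≠ 0 for all 0 ≤ i < n−1. Then the ideal of R generated by x and σ^n(x) equals the ideal generated by x and y − λ. -/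
noncomputable section

/-- The sequence `λ_{-1} = 0`, `λ_0 = λ`, `λ_n = α·λ_{n-1} + β·λ_{n-2} + γ`,
shifted so that `lamSeq α β γ l n = λ_{n-1}` (thus `lamSeq α β γ l 0 = 0` and
`lamSeq α β γ l 1 = l`). -/
def lamSeq {K : Type} [Field K] (α β γ l : K) : ℕ → K
  | 0 => 0
  | 1 => l
  | (n + 2) => α * lamSeq α β γ l (n + 1) + β * lamSeq α β γ l n + γ


theorem lamSeq_eq_mul_add {K : Type} [Field K] (α β γ l : K) (n : ℕ) :
    lamSeq α β γ l n = lamSeq α β 0 1 n * l + lamSeq α β γ 0 n := by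
  induction n using Nat.twoStepInduction with
  | zero => simp [lamSeq]
  | one => simp [lamSeq]
  | more n ih₀ ih₁ =>
    simp only [lamSeq]
    rw [ih₀, ih₁]
    ring

theorem sub_one_mul_lamSeq_zero {K : Type} [Field K] (η γ : K) (n : ℕ) :
    (η - 1) * lamSeq (1 + η) (-η) γ 0 n =
      γ * (lamSeq (1 + η) (-η) 0 1 n - n) := by
  induction n using Nat.twoStepInduction with
  | zero => simp [lamSeq]
  | one => simp [lamSeq]
  | more n ih₀ ih₁ =>
    simp only [lamSeq]
    push_cast at ih₁ ⊢
    linear_combination (1 + η) * ih₁ - η * ih₀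

theorem lamSeq_zero_one_ne_zero {K : Type} [Field K] [CharZero K] {η γ l : K}
    (hγ : γ ≠ 0) {n : ℕ} (hn : n ≠ 0)
    (h : lamSeq (1 + η) (-η) γ l n = 0) : lamSeq (1 + η) (-η) 0 1 n ≠ 0 := by
  intro hs
  have hc := sub_one_mul_lamSeq_zero η γ n
  rw [lamSeq_eq_mul_add, hs, zero_mul, zero_add] at h
  rw [h, hs, mul_zero, zero_sub, eq_comm, mul_eq_zero, neg_eq_zero, Nat.cast_eq_zero] at hc
  exact hc.elim hγ hn

open MvPolynomial in
theorem X_dvd_pow_apply_X_sub {K : Type} [Field K] {α β γ : K}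
    {σ : MvPolynomial (Fin 2) K →ₐ[K] MvPolynomial (Fin 2) K}
    (hx : σ (X 0) = X 1) (hy : σ (X 1) = C α * X 1 + C β * X 0 + C γ) (n : ℕ) :
    X 0 ∣ (σ ^ n) (X 0) - (C (lamSeq α β 0 1 n) * X 1 + C (lamSeq α β γ 0 n)) := by
  induction n using Nat.twoStepInduction with
  | zero => simp [lamSeq]
  | one => simp [lamSeq, hx]
  | more n ih₀ ih₁ =>
    have hC (a : K) : (σ ^ n) (C a) = C a := (σ ^ n).commutes a
    have h₁ : (σ ^ (n + 1)) (X 0) = (σ ^ n) (X 1) := by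
      rw [pow_succ, AlgHom.mul_apply, hx]
    have h₂ : (σ ^ (n + 2)) (X 0) =
        C α * (σ ^ (n + 1)) (X 0) + C β * (σ ^ n) (X 0) + C γ := by
      rw [h₁, pow_add, pow_two, AlgHom.mul_apply, AlgHom.mul_apply, hx, hy]
      simp only [map_add, map_mul, hC]
    rw [h₂]
    convert dvd_add (ih₁.mul_left (C α)) (ih₀.mul_left (C β)) using 1
    simp only [lamSeq, map_add, map_mul, map_zero]
    ring

open MvPolynomial in
/-- for `A_η` parameters (`α = 1+η`, `β = −η`, `η ≠ 0,1`,
`γ ≠ 0`, `char K = 0`), if `dim L(λ) = n`, i.e. `λ_{n−1} = 0` and `λ_i ≠ 0`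
for `0 ≤ i < n−1`, then `(x, σ^n(x)) = (x, y − λ)` in `K[x,y]`.
(Recall `lamSeq α β γ l k = λ_{k-1}`.) -/
theorem downUp_eta_span_x_sigma_pow_x (K : Type) [Field K] [IsAlgClosed K]
    [CharZero K] (η γ : K) (hη0 : η ≠ 0) (hη1 : η ≠ 1) (hγ : γ ≠ 0)
    (σ : MvPolynomial (Fin 2) K →ₐ[K] MvPolynomial (Fin 2) K)
    (hx : σ (X 0) = X 1)
    (hy : σ (X 1) = C (1 + η) * X 1 + C (-η) * X 0 + C γ)
    (lam : K) (n : ℕ) (hn : 1 ≤ n)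
    (hvanish : lamSeq (1 + η) (-η) γ lam n = 0)
    (hnonzero : ∀ i : ℕ, i + 1 < n → lamSeq (1 + η) (-η) γ lam (i + 1) ≠ 0) :
    Ideal.span {X 0, (σ ^ n) (X 0)} =
      Ideal.span {X 0, X 1 - C lam} := by
  have hs := lamSeq_zero_one_ne_zero hγ (Nat.one_le_iff_ne_zero.mp hn) hvanish
  obtain ⟨q, hq⟩ := X_dvd_pow_apply_X_sub hx hy n
  rw [lamSeq_eq_mul_add] at hvanish
  set s := lamSeq (1 + η) (-η) 0 1 n
  rw [eq_neg_of_add_eq_zero_right hvanish, C_neg, C_mul, sub_eq_iff_eq_add] at hq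
  have hu : IsUnit (C s : MvPolynomial (Fin 2) K) := (isUnit_iff_ne_zero.mpr hs).map C
  have hσ : (σ ^ n) (X 0) = C s * (X 1 - C lam) + q * X 0 := by
    rw [hq]
    ring
  rw [hσ, Ideal.span_pair_comm, Ideal.span_pair_add_mul_right, Ideal.span_pair_comm,
    Ideal.span_insert, Ideal.span_insert, Ideal.span_singleton_mul_left_unit hu]
end
end

section
/- Let K be an algebraically closed field of characteristic 0, let η ∈ K with η ≠ 0 and η ≠ 1, let γ ∈ K with γ ≠ 0, and let A = A(1+η, −η, γ). Let M be a finite-dimensional left A-module and L ⊆ M a submodule such that L and M/L are both simple, L is a highest weight module of weight λ for some λ ∈ K, and M/L is isomorphic to L as an A-module. Then the extension splits: there exists a submodule C of M with C ∩ L = 0 and C + L = M. -/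
noncomputable section

/-- Generators `d, u` of a `K`-algebra together with an element `e` such that
`[d, u] = c + e` and `e` commutes with `d` and `u` up to the scalar `η`. -/
structure IsSkewDownUp {K A : Type*} [Field K] [Ring A] [Algebra K A]
    (c η : K) (d u e : A) : Prop where
  adjoin_eq_top : Algebra.adjoin K {d, u} = ⊤
  d_mul_u : d * u = u * d + c • 1 + e
  d_mul_e : d * e = η • (e * d)
  e_mul_u : e * u = η • (u * e)

/-- The scalar by which `d` maps `u ^ (n + 1) • v` to `u ^ n • v`, for `v` killed by `d` and of
`e`-weight `κ`. -/
def skewWeight {K : Type*} [Field K] (c η κ : K) (n : ℕ) : K :=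
  (n + 1) * c + (∑ i ∈ Finset.range (n + 1), η ^ i) * κ

theorem linearIndependent_of_lowering {K V : Type*} [Field K] [AddCommGroup V] [Module K V]
    (D : V →ₗ[K] V) (x : ℕ → V) (l : ℕ → K) (hx : x 0 ≠ 0) (h0 : D (x 0) = 0)
    (hD : ∀ n, D (x (n + 1)) = l n • x n) (N : ℕ) (hl : ∀ i, i + 1 < N → l i ≠ 0) :
    LinearIndependent K (fun i : Fin N => x i) := by
  induction N with
  | zero => exact linearIndependent_empty_type
  | succ n ih =>
    have ih := Fintype.linearIndependent_iff.1 (ih fun i hi => hl i (by omega))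
    rw [Fintype.linearIndependent_iff]
    intro g hg
    rw [Fin.sum_univ_succ] at hg
    have hsucc : ∀ i : Fin n, g i.succ = 0 := by
      have h := congrArg D hg
      simp only [Fin.val_zero, Fin.val_succ, map_add, map_smul, map_sum, h0, hD, smul_zero,
        zero_add, map_zero, smul_smul] at h
      intro i
      exact (mul_eq_zero.1 (ih (fun i => g i.succ * l i) h i)).resolve_right (hl i (by omega))
    have hzero : g 0 = 0 := by
      simpa [hsucc, hx] using hg
    exact Fin.cases hzero hsucc

namespace IsSkewDownUp

section

variable {K A V : Type*} [Field K] [Ring A] [Algebra K A] [AddCommGroup V] [Module K V]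
  [Module A V] [IsScalarTower K A V] {c η κ : K} {d u e : A}

theorem of_downUp_relations {γ : K} (htop : Algebra.adjoin K {d, u} = ⊤)
    (hc : γ = c * (1 - η))
    (h₁ : d * d * u = (1 + η) • (d * u * d) + (-η) • (u * d * d) + γ • d)
    (h₂ : d * u * u = (1 + η) • (u * d * u) + (-η) • (u * u * d) + γ • u) :
    IsSkewDownUp c η d u (d * u - u * d - c • (1 : A)) := by
  refine ⟨htop, by abel, ?_, ?_⟩
  · simp only [mul_sub, sub_mul, ← mul_assoc, h₁, hc, smul_mul_assoc, mul_smul_comm, mul_one,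
      one_mul]
    generalize d * u * d = x, u * d * d = y
    module
  · simp only [mul_sub, sub_mul, ← mul_assoc, h₂, hc, smul_mul_assoc, mul_smul_comm, mul_one,
      one_mul]
    generalize u * d * u = x, u * u * d = y
    module

theorem e_smul_of_weight (h : IsSkewDownUp c η d u e) {l : K} {v : V} (hd : d • v = 0)
    (hl : (d * u) • v = l • v) : e • v = (l - c) • v := by
  rw [h.d_mul_u, add_smul, add_smul, mul_smul, hd, smul_zero, zero_add, smul_assoc, one_smul] at hl
  rw [sub_smul, ← hl, add_sub_cancel_left]

theorem smul_mem (h : IsSkewDownUp c η d u e) (S : Submodule K V)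
    (hd : ∀ x ∈ S, d • x ∈ S) (hu : ∀ x ∈ S, u • x ∈ S) (a : A) {x : V} (hx : x ∈ S) :
    a • x ∈ S := by
  have ha : a ∈ Algebra.adjoin K {d, u} := h.adjoin_eq_top ▸ Algebra.mem_top
  induction ha using Algebra.adjoin_induction generalizing x with
  | mem a ha =>
    rcases ha with rfl | rfl
    · exact hd x hx
    · exact hu x hx
  | algebraMap r => rw [algebraMap_smul]; exact S.smul_mem r hx
  | add a b _ _ iha ihb => rw [add_smul]; exact S.add_mem (iha hx) (ihb hx)
  | mul a b _ _ iha ihb => rw [mul_smul]; exact iha (ihb hx)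

theorem e_mul_u_pow (h : IsSkewDownUp c η d u e) (n : ℕ) :
    e * u ^ n = η ^ n • (u ^ n * e) := by
  induction n with
  | zero => simp
  | succ n ih =>
    rw [pow_succ, ← mul_assoc, ih, smul_mul_assoc, mul_assoc, h.e_mul_u, mul_smul_comm, smul_smul,
      ← pow_succ, mul_assoc]

theorem d_mul_u_pow (h : IsSkewDownUp c η d u e) (n : ℕ) :
    d * u ^ (n + 1) = u ^ (n + 1) * d + ((n + 1) * c) • u ^ n +
      (∑ i ∈ Finset.range (n + 1), η ^ i) • (u ^ n * e) := by
  induction n with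
  | zero => simp [h.d_mul_u]
  | succ n ih =>
    rw [pow_succ u (n + 1), ← mul_assoc, ih, geom_sum_succ (n := n + 1)]
    simp only [add_mul, smul_mul_assoc, mul_assoc, h.e_mul_u, h.d_mul_u, mul_add, mul_smul_comm,
      smul_smul, mul_one, ← pow_succ]
    simp only [← mul_assoc, ← pow_succ]
    push_cast
    module

theorem d_smul_u_pow_smul (h : IsSkewDownUp c η d u e) {v : V} (hd : d • v = 0)
    (he : e • v = κ • v) (n : ℕ) :
    d • u ^ (n + 1) • v = skewWeight c η κ n • u ^ n • v := by
  rw [smul_smul, h.d_mul_u_pow, add_smul, add_smul, mul_smul, hd, smul_assoc, smul_assoc,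
    mul_smul (u ^ n) e, he, smul_comm (u ^ n) κ v, skewWeight, smul_zero]
  generalize u ^ n • v = x
  module

theorem smul_mem_span (h : IsSkewDownUp c η d u e) {v : V} (hd : d • v = 0)
    (he : e • v = κ • v) (a : A) :
    a • v ∈ Submodule.span K (Set.range fun n : ℕ => u ^ n • v) := by
  have hv : ∀ n : ℕ, u ^ n • v ∈ Submodule.span K (Set.range fun n : ℕ => u ^ n • v) :=
    fun n => Submodule.subset_span ⟨n, rfl⟩
  refine h.smul_mem _ (fun x hx => ?_) (fun x hx => ?_) a (by simpa using hv 0)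
  · induction hx using Submodule.span_induction with
    | mem x hx =>
      obtain ⟨n, rfl⟩ := hx
      cases n with
      | zero => simp [hd]
      | succ n =>
        simp only [h.d_smul_u_pow_smul hd he]
        exact Submodule.smul_mem _ _ (hv n)
    | zero => simp
    | add x y _ _ hx hy => rw [smul_add]; exact Submodule.add_mem _ hx hy
    | smul r x _ hx => rw [smul_comm]; exact Submodule.smul_mem _ _ hx
  · induction hx using Submodule.span_induction with
    | mem x hx =>
      obtain ⟨n, rfl⟩ := hx
      simp only [smul_smul, ← pow_succ']
      exact hv (n + 1)
    | zero => simp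
    | add x y _ _ hx hy => rw [smul_add]; exact Submodule.add_mem _ hx hy
    | smul r x _ hx => rw [smul_comm]; exact Submodule.smul_mem _ _ hx

theorem smul_mem_span_fin (h : IsSkewDownUp c η d u e) {v : V} (hd : d • v = 0)
    (he : e • v = κ • v) {N : ℕ} (hN : u ^ N • v = 0) (a : A) :
    a • v ∈ Submodule.span K (Set.range fun n : Fin N => u ^ (n : ℕ) • v) := by
  refine (Submodule.span_le.2 ?_) (h.smul_mem_span hd he a)
  rintro _ ⟨n, rfl⟩
  by_cases hn : n < N
  · exact Submodule.subset_span ⟨⟨n, hn⟩, rfl⟩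
  · obtain ⟨k, rfl⟩ := Nat.exists_eq_add_of_le' (not_lt.1 hn)
    simp [pow_add, mul_smul, hN]

theorem linearIndependent_u_pow_smul (h : IsSkewDownUp c η d u e) {v : V} (hv : v ≠ 0)
    (hd : d • v = 0) (he : e • v = κ • v) (N : ℕ)
    (hl : ∀ i, i + 1 < N → skewWeight c η κ i ≠ 0) :
    LinearIndependent K (fun i : Fin N => u ^ (i : ℕ) • v) :=
  linearIndependent_of_lowering (Algebra.lsmul K K V d) (fun i => u ^ i • v) (skewWeight c η κ)
    (by simpa using hv) (by simpa using hd) (fun n => h.d_smul_u_pow_smul hd he n) N hl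

/-- If `u` acted bijectively, then `e` would have trace zero, since `e` is conjugate to `η • e`;
but `c + e` is a commutator. -/
theorem not_surjective_u [CharZero K] [FiniteDimensional K V] [Nontrivial V]
    (h : IsSkewDownUp c η d u e) (hc : c ≠ 0) (hη : η ≠ 1) :
    ¬ Function.Surjective (fun x : V => u • x) := by
  intro hs
  let ρ := Algebra.lsmul K K V (A := A)
  have hunit : IsUnit (ρ u) := by
    rw [Module.End.isUnit_iff]
    exact ⟨LinearMap.injective_iff_surjective.2 hs, hs⟩
  obtain ⟨U, hU⟩ := hunit
  have h1 : LinearMap.trace K V (ρ e) = η * LinearMap.trace K V (ρ e) := by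
    have h2 : ρ e = η • (U.val * ρ e * U⁻¹.val) := by
      rw [← smul_mul_assoc, hU, ← map_mul, ← map_smul, ← h.e_mul_u, map_mul, ← hU,
        Units.mul_inv_cancel_right]
    conv_lhs => rw [h2]
    rw [map_smul, LinearMap.trace_mul_comm, Units.inv_mul_cancel_left, smul_eq_mul]
  have h3 : LinearMap.trace K V (ρ e) = 0 := by
    have : (1 - η) * LinearMap.trace K V (ρ e) = 0 := by linear_combination h1
    exact (mul_eq_zero.1 this).resolve_left (sub_ne_zero.2 hη.symm)
  have h4 := congrArg (fun a => LinearMap.trace K V (ρ a)) h.d_mul_u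
  simp only [map_add, map_mul, map_smul, map_one, h3, LinearMap.trace_mul_comm K (ρ d),
    LinearMap.trace_one, add_zero, smul_eq_mul] at h4
  have h5 : c * (Module.finrank K V : K) = 0 := by linear_combination -h4
  rcases mul_eq_zero.1 h5 with h6 | h6
  · exact hc h6
  · exact Module.finrank_pos.ne' (Nat.cast_eq_zero.1 h6)

/-- The structure of a finite-dimensional simple highest weight module. -/
theorem exists_nilpotency_index [CharZero K] [FiniteDimensional K V] [IsSimpleModule A V]
    (h : IsSkewDownUp c η d u e) (hc : c ≠ 0) (hη : η ≠ 1) {v : V} (hv : v ≠ 0)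
    (hd : d • v = 0) (he : e • v = κ • v) :
    ∃ m, u ^ (m + 1) • v = 0 ∧ skewWeight c η κ m = 0 ∧ ∀ i < m, skewWeight c η κ i ≠ 0 := by
  have : Nontrivial V := IsSimpleModule.nontrivial A V
  have key : ∀ k, skewWeight c η κ k = 0 → u ^ (k + 1) • v = 0 := by
    intro k hk
    by_contra hne
    have hd' : d • u ^ (k + 1) • v = 0 := by rw [h.d_smul_u_pow_smul hd he, hk, zero_smul]
    have he' : e • u ^ (k + 1) • v = (η ^ (k + 1) * κ) • u ^ (k + 1) • v := by
      rw [smul_smul, h.e_mul_u_pow, smul_assoc, mul_smul, he, smul_comm (u ^ (k + 1)) κ v,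
        smul_smul]
    refine h.not_surjective_u (V := V) hc hη fun x => ?_
    obtain ⟨a, rfl⟩ := IsSimpleModule.toSpanSingleton_surjective A hne x
    have hle : Submodule.span K (Set.range fun n : ℕ => u ^ n • u ^ (k + 1) • v) ≤
        LinearMap.range (Algebra.lsmul K K V u) := by
      rw [Submodule.span_le]
      rintro _ ⟨n, rfl⟩
      refine ⟨u ^ (n + k) • v, ?_⟩
      simp only [Algebra.lsmul_coe, smul_smul, ← pow_succ', ← pow_add]
      rfl
    exact hle (h.smul_mem_span hd' he' a)
  have hex : ∃ k, skewWeight c η κ k = 0 := by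
    by_contra! hne
    have := (h.linearIndependent_u_pow_smul hv hd he (Module.finrank K V + 1)
      fun i _ => hne i).fintype_card_le_finrank
    simp at this
  classical
  exact ⟨Nat.find hex, key _ (Nat.find_spec hex), Nat.find_spec hex, fun i => Nat.find_min hex⟩

/-- A vector of an extension lying over a highest weight vector can be corrected to a highest
weight vector of the same weight. -/
theorem exists_highest_weight_lift [CharZero K] (h : IsSkewDownUp c η d u e) (hc : c ≠ 0)
    (hη : η ≠ 1) (θ : V →ₗ[A] V) {v : V} (hv : v ≠ 0) (hd : d • v = 0) (he : e • v = κ • v) {m : ℕ}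
    (hu : u ^ (m + 1) • v = 0) (hm : skewWeight c η κ m = 0)
    (hl : ∀ i < m, skewWeight c η κ i ≠ 0)
    (hker : ∀ x, θ x = 0 ↔ x ∈ Submodule.span K (Set.range fun n : Fin (m + 1) => u ^ (n : ℕ) • v))
    {w : V} (hw : θ w = v) :
    ∃ w, θ w = v ∧ d • w = 0 ∧ e • w = κ • w ∧ u ^ (m + 1) • w = 0 := by
  have hmc : ((m : K) + 1) * c ≠ 0 := mul_ne_zero (Nat.cast_add_one_ne_zero m) hc
  have hgeom : ∑ i ∈ Finset.range (m + 1), η ^ i ≠ 0 := by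
    intro h0
    rw [skewWeight, h0, zero_mul, add_zero] at hm
    exact hmc hm
  have hκ : κ ≠ 0 := by
    rintro rfl
    rw [skewWeight, mul_zero, add_zero] at hm
    exact hmc hm
  have hli := h.linearIndependent_u_pow_smul hv hd he (m + 1) fun i hi => hl i (by omega)
  have hd0 : ∀ a : Fin (m + 1) → K, d • ∑ i, a i • u ^ (i : ℕ) • v =
      ∑ i : Fin m, (a i.succ * skewWeight c η κ i) • u ^ (i : ℕ) • v := by
    intro a
    rw [Fin.sum_univ_succ, smul_add, smul_comm, Finset.smul_sum]
    simp only [Fin.val_zero, pow_zero, one_smul, hd, smul_zero, zero_add, Fin.val_succ]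
    refine Finset.sum_congr rfl fun i _ => ?_
    rw [smul_comm, h.d_smul_u_pow_smul hd he, smul_smul]
  have hrange : ∀ (x : V) (b : K), θ x = 0 → d • x = b • u ^ m • v → b = 0 := by
    intro x b hx hxb
    obtain ⟨a, rfl⟩ := (Submodule.mem_span_range_iff_exists_fun K).1 ((hker x).1 hx)
    rw [hd0] at hxb
    have := Fintype.linearIndependent_iff.1 hli
      (Fin.snoc (fun i : Fin m => a i.succ * skewWeight c η κ i) (-b))
      (by simp [Fin.sum_univ_castSucc, hxb]) (Fin.last m)
    simpa using this
  have hkernel : ∀ x, θ x = 0 → d • x = 0 → ∃ a : K, x = a • v := by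
    intro x hx hxd
    obtain ⟨a, rfl⟩ := (Submodule.mem_span_range_iff_exists_fun K).1 ((hker x).1 hx)
    rw [hd0] at hxd
    have hli' := h.linearIndependent_u_pow_smul hv hd he m fun i hi => hl i (by omega)
    have h0 : ∀ i : Fin m, a i.succ = 0 := fun i =>
      (mul_eq_zero.1 (Fintype.linearIndependent_iff.1 hli' _ hxd i)).resolve_right (hl i i.2)
    exact ⟨a 0, by simp [Fin.sum_univ_succ, h0]⟩
  have hdecomp : ∀ x, θ x = 0 → ∃ (b : K) (y : V), θ y = 0 ∧ x = d • y + b • u ^ m • v := by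
    intro x hx
    obtain ⟨a, rfl⟩ := (Submodule.mem_span_range_iff_exists_fun K).1 ((hker x).1 hx)
    let a' : Fin (m + 1) → K :=
      Fin.cons 0 fun i : Fin m => a i.castSucc * (skewWeight c η κ i)⁻¹
    refine ⟨a (Fin.last m), ∑ i, a' i • u ^ (i : ℕ) • v,
      (hker _).2 ((Submodule.mem_span_range_iff_exists_fun K).2 ⟨a', rfl⟩), ?_⟩
    rw [hd0, Fin.sum_univ_castSucc]
    congr 1
    refine Finset.sum_congr rfl fun i _ => ?_
    simp [a', hl i i.2]
  have heu : ∀ n, e • u ^ n • v = (η ^ n * κ) • u ^ n • v := by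
    intro n
    rw [smul_smul, h.e_mul_u_pow, smul_assoc, mul_smul, he, smul_comm (u ^ n) κ v, smul_smul]
  have hθK : ∀ (k : K) (x : V), θ (k • x) = k • θ x := fun k x => by
    rw [← algebraMap_smul A k x, map_smul, algebraMap_smul]
  have hηN : 1 - η ^ (m + 1) ≠ 0 := by
    intro h0
    have h1 : (η - 1) * ∑ i ∈ Finset.range (m + 1), η ^ i = 0 := by
      linear_combination mul_geom_sum η (m + 1) - h0
    exact (mul_eq_zero.1 h1).elim (sub_ne_zero.2 hη) hgeom
  obtain ⟨b, y, hy, hby⟩ := hdecomp (d • w) (by rw [map_smul, hw, hd])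
  obtain ⟨w, hw, hdw⟩ : ∃ w, θ w = v ∧ d • w = b • u ^ m • v :=
    ⟨w - y, by rw [map_sub, hw, hy, sub_zero], by rw [smul_sub, hby]; abel⟩
  have hew : θ (e • w - κ • w) = 0 := by rw [map_sub, map_smul, hθK, hw, he, sub_self]
  have hdew : d • (e • w - κ • w) = -(b * κ * (1 - η ^ (m + 1))) • u ^ m • v := by
    rw [smul_sub, smul_smul, h.d_mul_e, smul_assoc, mul_smul, hdw, smul_comm e b, heu,
      smul_comm d κ, hdw]
    generalize u ^ m • v = x
    module
  have hb : b = 0 := by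
    simpa [hκ, hηN] using hrange _ _ hew hdew
  rw [hb, zero_smul] at hdw
  rw [hb] at hdew
  obtain ⟨ν, hν⟩ := hkernel _ hew (by rw [hdew]; simp)
  have hew' : e • w = κ • w + ν • v := by rw [← hν]; abel
  have hθu : θ (u ^ (m + 1) • w) = 0 := by rw [map_smul, hw, hu]
  have hdu : d • u ^ (m + 1) • w =
      ((∑ i ∈ Finset.range (m + 1), η ^ i) * ν) • u ^ m • v := by
    have : d • u ^ (m + 1) • w = skewWeight c η κ m • u ^ m • w +
        ((∑ i ∈ Finset.range (m + 1), η ^ i) * ν) • u ^ m • v := by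
      rw [smul_smul, h.d_mul_u_pow, add_smul, add_smul, mul_smul, hdw, smul_assoc, smul_assoc,
        mul_smul (u ^ m) e, hew', smul_add, smul_comm (u ^ m) κ, smul_comm (u ^ m) ν, skewWeight,
        smul_zero]
      generalize u ^ m • v = x
      generalize u ^ m • w = y
      module
    rw [this, hm, zero_smul, zero_add]
  have hν0 : ν = 0 := (mul_eq_zero.1 (hrange _ _ hθu hdu)).resolve_left hgeom
  rw [hν0, zero_smul, add_zero] at hew'
  obtain ⟨r, hr⟩ := hkernel _ hθu (by rw [hdu, hν0, mul_zero, zero_smul])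
  refine ⟨w, hw, hdw, hew', ?_⟩
  have h1 : e • u ^ (m + 1) • w = (η ^ (m + 1) * κ) • u ^ (m + 1) • w := by
    rw [smul_smul, h.e_mul_u_pow, smul_assoc, mul_smul, hew', smul_comm (u ^ (m + 1)) κ w,
      smul_smul]
  rw [hr, smul_comm e r, he, smul_smul, smul_smul, ← sub_eq_zero, ← sub_smul, smul_eq_zero] at h1
  have h2 : r * κ * (1 - η ^ (m + 1)) = 0 := by linear_combination h1.resolve_right hv
  rw [hr, (by simpa [hκ, hηN] using h2 : r = 0), zero_smul]

/-- A self-extension `V` of a finite-dimensional simple highest weight module `L` splits. -/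
theorem exists_complement [CharZero K] [FiniteDimensional K V] (h : IsSkewDownUp c η d u e)
    (hc : c ≠ 0) (hη : η ≠ 1) (L : Submodule A V) [IsSimpleModule A L] {l : K} {v : L}
    (hdv : d • v = 0) (hev : (d * u) • v = l • v) (hgen : ∀ x : L, ∃ a : A, x = a • v)
    (φ : (V ⧸ L) ≃ₗ[A] L) :
    ∃ C : Submodule A V, C ⊓ L = ⊥ ∧ C ⊔ L = ⊤ := by
  have : Nontrivial L := IsSimpleModule.nontrivial A L
  have : FiniteDimensional K L :=
    FiniteDimensional.of_injective (L.subtype.restrictScalars K) L.injective_subtype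
  have hv : v ≠ 0 := by
    rintro rfl
    obtain ⟨x, hx⟩ := exists_ne (0 : L)
    obtain ⟨a, rfl⟩ := hgen x
    exact hx (smul_zero a)
  have he := h.e_smul_of_weight hdv hev
  obtain ⟨m, hum, hm, hl⟩ := h.exists_nilpotency_index hc hη hv hdv he
  let θ : V →ₗ[A] V := L.subtype ∘ₗ φ.toLinearMap ∘ₗ L.mkQ
  have hθ : ∀ x, θ x = 0 ↔ x ∈ L := fun x => by simp [θ]
  have hdv' : d • (v : V) = 0 := congrArg Subtype.val hdv
  have he' : e • (v : V) = (l - c) • (v : V) := congrArg Subtype.val he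
  have hum' : u ^ (m + 1) • (v : V) = 0 := congrArg Subtype.val hum
  have hv' : (v : V) ≠ 0 := by simpa using hv
  obtain ⟨w₀, hw₀⟩ : ∃ w, θ w = v := by
    obtain ⟨w, hw⟩ := L.mkQ_surjective (φ.symm v)
    exact ⟨w, by simp [θ, -Submodule.mkQ_apply, hw]⟩
  have hspan : ∀ x, θ x = 0 ↔
      x ∈ Submodule.span K (Set.range fun n : Fin (m + 1) => u ^ (n : ℕ) • (v : V)) := by
    intro x
    rw [hθ]
    constructor
    · intro hx
      obtain ⟨a, ha⟩ := hgen ⟨x, hx⟩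
      rw [show x = a • (v : V) from congrArg Subtype.val ha]
      exact h.smul_mem_span_fin hdv' he' hum' a
    · intro hx
      refine (Submodule.span_le (p := L.restrictScalars K)).2 ?_ hx
      rintro _ ⟨n, rfl⟩
      exact L.smul_mem _ v.2
  obtain ⟨w, hw, hdw, hew, huw⟩ :=
    h.exists_highest_weight_lift hc hη θ hv' hdv' he' hum' hm hl hspan hw₀
  refine ⟨Submodule.span A {w}, ?_, ?_⟩
  · rw [eq_bot_iff]
    rintro x ⟨hxC, hxL⟩
    obtain ⟨a, rfl⟩ := Submodule.mem_span_singleton.1 hxC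
    obtain ⟨f, hf⟩ := (Submodule.mem_span_range_iff_exists_fun K).1
      (h.smul_mem_span_fin hdw hew huw a)
    have h0 : θ.restrictScalars K (a • w) = 0 := (hθ _).2 hxL
    rw [← hf, map_sum] at h0
    have hθu : ∀ n : ℕ, θ.restrictScalars K (u ^ n • w) = u ^ n • (v : V) := fun n => by
      rw [LinearMap.restrictScalars_apply, map_smul, hw]
    simp only [map_smul, hθu] at h0
    have hf0 := Fintype.linearIndependent_iff.1
      (h.linearIndependent_u_pow_smul hv' hdv' he' (m + 1) fun i hi => hl i (by omega)) f h0
    rw [← hf]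
    simp [hf0]
  · rw [eq_top_iff]
    intro x _
    obtain ⟨a, ha⟩ := hgen (φ (L.mkQ x))
    have hθx : θ x = a • (v : V) := congrArg Subtype.val ha
    refine Submodule.mem_sup.2 ⟨a • w, Submodule.smul_mem _ a (Submodule.mem_span_singleton_self w),
      x - a • w, (hθ _).1 ?_, by abel⟩
    rw [map_sub, map_smul, hw, hθx, sub_self]

end

end IsSkewDownUp

theorem DownUp.adjoin_d_u (K : Type) [Field K] (α β γ : K) :
    Algebra.adjoin K {DownUp.d K α β γ, DownUp.u K α β γ} = ⊤ := by
  have h : Set.range (FreeAlgebra.ι K : Fin 2 → _) = {FreeAlgebra.ι K 0, FreeAlgebra.ι K 1} := by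
    ext x
    simp [Fin.exists_fin_two, eq_comm]
  have := congrArg (Subalgebra.map (RingQuot.mkAlgHom K (DownUpRel K α β γ)))
    (FreeAlgebra.adjoin_range_ι (R := K) (X := Fin 2))
  rwa [AlgHom.map_adjoin, h, Set.image_pair, Algebra.map_top,
    (AlgHom.range_eq_top _).2 (RingQuot.mkAlgHom_surjective K _)] at this

theorem DownUp.isSkewDownUp (K : Type) [Field K] (η γ : K) (hη : η ≠ 1) :
    IsSkewDownUp (γ / (1 - η)) η (DownUp.d K (1 + η) (-η) γ) (DownUp.u K (1 + η) (-η) γ)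
      (DownUp.d K (1 + η) (-η) γ * DownUp.u K (1 + η) (-η) γ -
        DownUp.u K (1 + η) (-η) γ * DownUp.d K (1 + η) (-η) γ -
        (γ / (1 - η)) • (1 : DownUp K (1 + η) (-η) γ)) := by
  refine .of_downUp_relations (DownUp.adjoin_d_u K _ _ _)
    (div_mul_cancel₀ _ (sub_ne_zero.2 hη.symm)).symm ?_ ?_
  · have := RingQuot.mkAlgHom_rel K (DownUpRel.rel1 (K := K) (α := 1 + η) (β := -η) (γ := γ))
    simp only [map_add, map_mul, map_smul] at this
    exact this
  · have := RingQuot.mkAlgHom_rel K (DownUpRel.rel2 (K := K) (α := 1 + η) (β := -η) (γ := γ))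
    simp only [map_add, map_mul, map_smul] at this
    exact this

/-- over `A_η = A(1+η, −η, γ)` with `η ≠ 0,1`, `γ ≠ 0`,
`char K = 0`, there are no nonsplit self-extensions of a finite-dimensional
simple highest weight module `L(λ)`: if `L ⊆ M` with `L` and `M/L` simple,
`L` a highest weight module of weight `λ` and `M/L ≅ L`, then `L` has a
complement in `M`. -/
theorem downUp_eta_no_self_extensions (K : Type) [Field K] [IsAlgClosed K]
    [CharZero K] (η γ : K) (hη0 : η ≠ 0) (hη1 : η ≠ 1) (hγ : γ ≠ 0) (lam : K)
    (M : Type) [AddCommGroup M] [Module K M] [Module (DownUp K (1 + η) (-η) γ) M]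
    [IsScalarTower K (DownUp K (1 + η) (-η) γ) M] [FiniteDimensional K M]
    (L : Submodule (DownUp K (1 + η) (-η) γ) M)
    [IsSimpleModule (DownUp K (1 + η) (-η) γ) L]
    [IsSimpleModule (DownUp K (1 + η) (-η) γ) (M ⧸ L)]
    -- `L` is a highest weight module of weight `λ`:
    (hL : ∃ v : L, DownUp.d K (1 + η) (-η) γ • v = 0 ∧
        (DownUp.d K (1 + η) (-η) γ * DownUp.u K (1 + η) (-η) γ) • v =
          algebraMap K (DownUp K (1 + η) (-η) γ) lam • v ∧
        ∀ x : L, ∃ a : DownUp K (1 + η) (-η) γ, x = a • v)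
    -- `M/L` is isomorphic to `L` as an `A`-module:
    (hQ : Nonempty ((M ⧸ L) ≃ₗ[DownUp K (1 + η) (-η) γ] L)) :
    ∃ C : Submodule (DownUp K (1 + η) (-η) γ) M, C ⊓ L = ⊥ ∧ C ⊔ L = ⊤ := by
  obtain ⟨v, hdv, hev, hgen⟩ := hL
  obtain ⟨φ⟩ := hQ
  rw [algebraMap_smul] at hev
  exact (DownUp.isSkewDownUp K η γ hη1).exists_complement
    (div_ne_zero hγ (sub_ne_zero.2 hη1.symm)) hη1 L hdv hev hgen φ
end
end
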